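/- arXiv:2212.09810 — 7 statements merged into one kernel-verified Lean document; each statement's English description precedes it below -/
import Mathlib

section
/- For every prime p in 𝒫, every integer n ≥ 0, and every integer α with 0 ≤ α < p and α ≠ ⌊p/24⌋, the number of 3-regular partitions of 2(p²n + pα + t) is even, where t is the unique integer with 1 ≤ t ≤ p−1 and 24t ≡ −1 (mod p). -/
/-- The number of 3-regular partitions of `n`, i.e. partitions with no part divisible by 3. -/
noncomputable def b3 (n : ℕ) : ℕ := Nat.card {p : Nat.Partition n // ∀ i ∈ p.parts, ¬ (3 ∣ i)}

open Finset Filter Topology PowerSeries PowerSeries.WithPiTopology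

section GaussBinom

variable {R : Type*} [CommRing R]

/-- The Gaussian binomial coefficient `[n choose k]` evaluated at `q`. -/
def gaussBinom (q : R) : ℕ → ℕ → R
  | _, 0 => 1
  | 0, _ + 1 => 0
  | n + 1, k + 1 => gaussBinom q n k + q ^ (k + 1) * gaussBinom q n (k + 1)

@[simp]
theorem gaussBinom_zero_right (q : R) (n : ℕ) : gaussBinom q n 0 = 1 := by
  cases n <;> rfl

theorem gaussBinom_succ_succ (q : R) (n k : ℕ) :
    gaussBinom q (n + 1) (k + 1) = gaussBinom q n k + q ^ (k + 1) * gaussBinom q n (k + 1) := rfl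

theorem gaussBinom_eq_zero_of_lt (q : R) {n k : ℕ} (h : n < k) : gaussBinom q n k = 0 := by
  induction n generalizing k with
  | zero => obtain ⟨k, rfl⟩ := Nat.exists_eq_succ_of_ne_zero h.ne'; rfl
  | succ n ih =>
    obtain ⟨k, rfl⟩ := Nat.exists_eq_succ_of_ne_zero (Nat.ne_zero_of_lt h)
    rw [Nat.succ_eq_add_one, gaussBinom_succ_succ, ih (by omega), ih (by omega)]
    simp

/-- The finite `q`-Pochhammer product `∏_{i = 1}^{n} (1 - q ^ i)`. -/
def qFactorial (q : R) (n : ℕ) : R := ∏ i ∈ range n, (1 - q ^ (i + 1))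

@[simp]
theorem qFactorial_zero (q : R) : qFactorial q 0 = 1 := by simp [qFactorial]

theorem qFactorial_succ (q : R) (n : ℕ) :
    qFactorial q (n + 1) = qFactorial q n * (1 - q ^ (n + 1)) := prod_range_succ _ _

theorem gaussBinom_mul_qFactorial (q : R) (i j : ℕ) :
    gaussBinom q (i + j) i * qFactorial q i * qFactorial q j = qFactorial q (i + j) := by
  suffices ∀ n i j, i + j = n →
      gaussBinom q n i * qFactorial q i * qFactorial q j = qFactorial q n from this _ i j rfl
  intro n
  induction n with
  | zero =>
    rintro i j h
    obtain ⟨rfl, rfl⟩ : i = 0 ∧ j = 0 := by omega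
    simp
  | succ n ih =>
    rintro i j h
    rcases i with _ | i
    · obtain rfl : j = n + 1 := by omega
      simp
    rw [gaussBinom_succ_succ]
    rcases j with _ | j
    · obtain rfl : i = n := by omega
      rw [gaussBinom_eq_zero_of_lt q (Nat.lt_succ_self i)]
      have h0 := ih i 0 rfl
      rw [qFactorial_succ]
      linear_combination (1 - q ^ (i + 1)) * h0
    · have h1 := ih i (j + 1) (by omega)
      have h2 := ih (i + 1) j (by omega)
      obtain rfl : n = i + j + 1 := by omega
      rw [qFactorial_succ q (i + j + 1)]
      linear_combination (1 - q ^ (i + 1)) * h1 + q ^ (i + 1) * (1 - q ^ (j + 1)) * h2 +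
        gaussBinom q (i + j + 1) i * qFactorial q (j + 1) * qFactorial_succ q i +
        q ^ (i + 1) * gaussBinom q (i + j + 1) (i + 1) * qFactorial q (i + 1) * qFactorial_succ q j

/-- The exponent `a j² + b j` of a general theta series, as a natural number. -/
def thetaExp (a b : ℕ) (j : ℤ) : ℕ := (a * j ^ 2 + b * j : ℤ).toNat

theorem natCast_thetaExp {a b : ℕ} (h : b ≤ a) (j : ℤ) :
    (thetaExp a b j : ℤ) = a * j ^ 2 + b * j := by
  apply Int.toNat_of_nonneg
  have h' : (b : ℤ) ≤ a := by exact_mod_cast h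
  have hb : (0 : ℤ) ≤ b := by positivity
  rcases le_or_gt 0 j with hj | hj
  · positivity
  · nlinarith [mul_nonneg (sub_nonneg.2 h') (sq_nonneg j), mul_nonneg hb (neg_nonneg.2 hj.le),
      mul_nonneg (mul_nonneg hb (neg_nonneg.2 hj.le)) (show (0 : ℤ) ≤ -(j + 1) by omega)]

theorem prod_one_add_pow_eq_sum_gaussBinom (x : R) (a b N : ℕ) :
    ∏ n ∈ range N, (1 + x ^ (a * (2 * n + 1) + b)) =
      ∑ k ∈ range (N + 1), gaussBinom (x ^ (2 * a)) N k * x ^ (a * k ^ 2 + b * k) := by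
  induction N generalizing b with
  | zero => simp
  | succ N ih =>
    have hshift : ∀ n, a * (2 * (n + 1) + 1) + b = a * (2 * n + 1) + (b + 2 * a) := by
      intro n; ring
    rw [prod_range_succ']
    simp_rw [hshift]
    rw [ih, sum_range_succ' _ (N + 1)]
    simp_rw [gaussBinom_succ_succ, add_mul (gaussBinom _ _ _), sum_add_distrib]
    have hlast := sum_range_succ' (fun k => gaussBinom (x ^ (2 * a)) N k *
      x ^ (a * k ^ 2 + (b + 2 * a) * k)) (N + 1)
    rw [sum_range_succ, gaussBinom_eq_zero_of_lt _ (Nat.lt_succ_self N)] at hlast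
    simp only [zero_mul, add_zero, gaussBinom_zero_right] at hlast
    rw [mul_add, mul_one]
    nth_rewrite 1 [hlast]
    rw [sum_mul]
    have e1 : ∀ k, gaussBinom (x ^ (2 * a)) N k * x ^ (a * k ^ 2 + (b + 2 * a) * k) *
        x ^ (a * (2 * 0 + 1) + b) =
        gaussBinom (x ^ (2 * a)) N k * x ^ (a * (k + 1) ^ 2 + b * (k + 1)) := by
      intro k; ring
    have e2 : ∀ k, gaussBinom (x ^ (2 * a)) N (k + 1) *
        x ^ (a * (k + 1) ^ 2 + (b + 2 * a) * (k + 1)) =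
        (x ^ (2 * a)) ^ (k + 1) * gaussBinom (x ^ (2 * a)) N (k + 1) *
          x ^ (a * (k + 1) ^ 2 + b * (k + 1)) := by
      intro k; ring
    simp_rw [e1, e2]
    simp only [gaussBinom_zero_right]
    ring

theorem prod_one_add_pow_mul_prod_eq_sum_gaussBinom (x : R) {a b : ℕ} (hab : b ≤ a) (N M : ℕ) :
    (∏ n ∈ range N, (1 + x ^ (a * (2 * n + 1) + b))) *
      ∏ n ∈ range M, (1 + x ^ (a * (2 * n + 1) - b)) =
      ∑ k ∈ range (M + N + 1),
        gaussBinom (x ^ (2 * a)) (M + N) k * x ^ thetaExp a b ((k : ℤ) - M) := by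
  induction M with
  | zero =>
    rw [range_zero, prod_empty, mul_one, prod_one_add_pow_eq_sum_gaussBinom, zero_add]
    refine sum_congr rfl fun k _ => ?_
    congr 2
  | succ M ih =>
    rw [prod_range_succ, ← mul_assoc, ih, show M + 1 + N = M + N + 1 by ring,
      sum_range_succ' _ (M + N + 1)]
    simp_rw [gaussBinom_succ_succ, add_mul, sum_add_distrib]
    have hle : b ≤ a * (2 * M + 1) := hab.trans (Nat.le_mul_of_pos_right _ (by omega))
    have hlast := sum_range_succ' (fun k : ℕ => gaussBinom (x ^ (2 * a)) (M + N) k *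
      x ^ (thetaExp a b ((k : ℤ) - M))) (M + N + 1)
    rw [sum_range_succ, gaussBinom_eq_zero_of_lt _ (Nat.lt_succ_self (M + N))] at hlast
    simp only [zero_mul, add_zero, gaussBinom_zero_right, one_mul] at hlast
    rw [mul_add, mul_one]
    nth_rewrite 2 [hlast]
    rw [add_mul, sum_mul]
    have e0 : x ^ thetaExp a b (((0 : ℕ) : ℤ) - M) * x ^ (a * (2 * M + 1) - b) =
        x ^ thetaExp a b (((0 : ℕ) : ℤ) - ((M + 1 : ℕ) : ℤ)) := by
      rw [← pow_add]
      congr 1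
      zify [hle]
      rw [natCast_thetaExp hab, natCast_thetaExp hab]
      ring
    have e1 : ∀ k : ℕ, (((k + 1 : ℕ) : ℤ) - ((M + 1 : ℕ) : ℤ)) = (k : ℤ) - M := by
      intro k; push_cast; ring
    have e2 : ∀ k : ℕ, gaussBinom (x ^ (2 * a)) (M + N) (k + 1) *
        x ^ thetaExp a b (((k + 1 : ℕ) : ℤ) - M) * x ^ (a * (2 * M + 1) - b) =
        (x ^ (2 * a)) ^ (k + 1) * gaussBinom (x ^ (2 * a)) (M + N) (k + 1) *
          x ^ thetaExp a b ((k : ℤ) - M) := by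
      intro k
      have : x ^ thetaExp a b (((k + 1 : ℕ) : ℤ) - M) * x ^ (a * (2 * M + 1) - b) =
          (x ^ (2 * a)) ^ (k + 1) * x ^ thetaExp a b ((k : ℤ) - M) := by
        rw [← pow_add, ← pow_mul, ← pow_add]
        congr 1
        zify [hle]
        rw [natCast_thetaExp hab, natCast_thetaExp hab]
        ring
      linear_combination gaussBinom (x ^ (2 * a)) (M + N) (k + 1) * this
    simp_rw [e0, e1, e2]
    simp only [gaussBinom_zero_right]
    ring

end GaussBinom

section TripleProduct

variable {R : Type*} [CommRing R]

theorem X_pow_dvd_qFactorial_sub (a d : ℕ) (ha : 0 < a) {m n : ℕ} (hm : d ≤ m) (hmn : m ≤ n) :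
    (X : R⟦X⟧) ^ (d + 1) ∣ qFactorial (X ^ (2 * a)) n - qFactorial (X ^ (2 * a)) m := by
  induction n, hmn using Nat.le_induction with
  | base => simp
  | succ n hn ih =>
    rw [qFactorial_succ]
    have : (X : R⟦X⟧) ^ (d + 1) ∣ (X ^ (2 * a)) ^ (n + 1) := by
      rw [← pow_mul]
      exact pow_dvd_pow _ (by nlinarith)
    convert dvd_sub ih (this.mul_left (qFactorial (X ^ (2 * a)) n)) using 1
    ring

theorem isUnit_qFactorial_X_pow {c : ℕ} (hc : c ≠ 0) (n : ℕ) :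
    IsUnit (qFactorial ((X : R⟦X⟧) ^ c) n) := by
  rw [isUnit_iff_constantCoeff]
  simp [qFactorial, map_prod, hc]

/-- The general theta series `∑_{j ∈ ℤ} X ^ (a j² + b j)` (for `0 < b < a`, when the exponents are
distinct), defined through its coefficients. -/
noncomputable def thetaSeries (R : Type*) [CommRing R] (a b : ℕ) : R⟦X⟧ :=
  open Classical in PowerSeries.mk fun d => if ∃ j : ℤ, a * j ^ 2 + b * j = d then 1 else 0

open Classical in
theorem coeff_thetaSeries (a b d : ℕ) :
    coeff d (thetaSeries R a b) = if ∃ j : ℤ, a * j ^ 2 + b * j = d then 1 else 0 := by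
  rw [thetaSeries, coeff_mk]

theorem abs_le_thetaExp {a b : ℕ} (h : b < a) (j : ℤ) : |j| ≤ thetaExp a b j := by
  rw [natCast_thetaExp h.le]
  have h' : (b : ℤ) + 1 ≤ a := by exact_mod_cast h
  have hb : (0 : ℤ) ≤ b := by positivity
  rcases le_or_gt 0 j with hj | hj
  · rw [abs_of_nonneg hj]
    rcases hj.eq_or_lt with rfl | hj
    · simp
    · nlinarith [mul_nonneg (sub_nonneg.2 h') (sq_nonneg j), mul_nonneg hb hj.le, sq_nonneg j]
  · rw [abs_of_neg hj]
    nlinarith [mul_nonneg (sub_nonneg.2 h') (sq_nonneg j), mul_nonneg hb (neg_nonneg.2 hj.le),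
      mul_nonneg (mul_nonneg hb (neg_nonneg.2 hj.le)) (show (0 : ℤ) ≤ -(j + 1) by omega),
      mul_nonneg (neg_nonneg.2 hj.le) (show (0 : ℤ) ≤ -(j + 1) by omega)]

theorem thetaExp_injective {a b : ℕ} (hb : 0 < b) (h : b < a) :
    Function.Injective (thetaExp a b) := by
  intro i j hij
  have hij' : (thetaExp a b i : ℤ) = thetaExp a b j := by rw [hij]
  rw [natCast_thetaExp h.le, natCast_thetaExp h.le] at hij'
  have h0 : (i - j) * (a * (i + j) + b) = 0 := by linear_combination hij'
  rcases mul_eq_zero.1 h0 with h0 | h0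
  · omega
  · exfalso
    have h1 : (a : ℤ) ∣ b := ⟨-(i + j), by linear_combination h0⟩
    have := Nat.le_of_dvd hb (by exact_mod_cast h1)
    omega

/-- The coefficients of the finite triple product stabilise. -/
theorem coeff_gaussBinom_mul_qFactorial {a d N k : ℕ} (ha : 0 < a) (hd : d ≤ N) (hk : d ≤ k)
    (hk' : k + d ≤ N + N) (e : ℕ) :
    coeff d (gaussBinom ((X : R⟦X⟧) ^ (2 * a)) (N + N) k * X ^ e * qFactorial (X ^ (2 * a)) N) =
      if e = d then 1 else 0 := by
  set P : ℕ → R⟦X⟧ := qFactorial (X ^ (2 * a)) with hP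
  set g := gaussBinom ((X : R⟦X⟧) ^ (2 * a)) (N + N) k
  have hcongr : ∀ m, d ≤ m → (X : R⟦X⟧) ^ (d + 1) ∣ P m - P d := fun m hm =>
    X_pow_dvd_qFactorial_sub a d ha le_rfl hm
  obtain ⟨l, hl⟩ : ∃ l, N + N = k + l := ⟨N + N - k, by omega⟩
  have hprod : g * P k * P l = P (N + N) := by
    have := gaussBinom_mul_qFactorial ((X : R⟦X⟧) ^ (2 * a)) k l
    rwa [← hl] at this
  have h1 : (X : R⟦X⟧) ^ (d + 1) ∣ (g * P N - 1) * P d := by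
    have e : (g * P N - 1) * P d = g * P d * (P N - P d) - g * P l * (P k - P d)
        - g * P d * (P l - P d) + (P (N + N) - P d) := by
      linear_combination hprod
    rw [e]
    exact dvd_add (dvd_sub (dvd_sub ((hcongr N hd).mul_left _) ((hcongr k hk).mul_left _))
      ((hcongr l (by omega)).mul_left _)) (hcongr _ (by omega))
  have h2 : (X : R⟦X⟧) ^ (d + 1) ∣ g * P N - 1 :=
    ((isUnit_qFactorial_X_pow (by omega) d).dvd_mul_right).1 h1
  have h3 : coeff d ((g * P N - 1) * X ^ e) = 0 :=
    (X_pow_dvd_iff.1 (h2.mul_right _)) d (Nat.lt_succ_self d)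
  rw [show g * X ^ e * P N = (g * P N - 1) * X ^ e + X ^ e by ring, map_add, h3, zero_add,
    coeff_X_pow]
  simp [eq_comm]

/-- The **Jacobi triple product** for power series. -/
theorem tendsto_jacobi_triple_product [TopologicalSpace R] {a b : ℕ} (hb : 0 < b) (hab : b < a) :
    Tendsto (fun N => (∏ n ∈ range N, (1 + (X : R⟦X⟧) ^ (a * (2 * n + 1) + b))) *
      (∏ n ∈ range N, (1 + (X : R⟦X⟧) ^ (a * (2 * n + 1) - b))) *
      ∏ n ∈ range N, (1 - (X : R⟦X⟧) ^ (2 * a * (n + 1)))) atTop (𝓝 (thetaSeries R a b)) := by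
  classical
  rw [tendsto_iff_coeff_tendsto]
  intro d
  refine tendsto_atTop_of_eventually_const (i₀ := d + d) fun N hN => ?_
  rw [prod_one_add_pow_mul_prod_eq_sum_gaussBinom _ hab.le, sum_mul, map_sum, coeff_thetaSeries]
  have hP : ∏ n ∈ range N, (1 - (X : R⟦X⟧) ^ (2 * a * (n + 1))) = qFactorial (X ^ (2 * a)) N := by
    simp [qFactorial, pow_mul]
  rw [hP]
  have key : ∀ k ∈ range (N + N + 1),
      coeff d (gaussBinom ((X : R⟦X⟧) ^ (2 * a)) (N + N) k * X ^ thetaExp a b ((k : ℤ) - N) *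
        qFactorial (X ^ (2 * a)) N) = if thetaExp a b ((k : ℤ) - N) = d then 1 else 0 := by
    intro k _
    rcases le_or_gt (thetaExp a b ((k : ℤ) - N)) d with hle | hlt
    · have hj := abs_le_thetaExp hab ((k : ℤ) - N)
      rw [abs_le] at hj
      exact coeff_gaussBinom_mul_qFactorial (by omega) (by omega) (by omega) (by omega) _
    · rw [if_neg hlt.ne', mul_right_comm, coeff_mul_X_pow', if_neg (by omega)]
  rw [sum_congr rfl key]
  split_ifs with h
  · obtain ⟨j, hj⟩ := h
    have hjd : thetaExp a b j = d := by zify; rw [natCast_thetaExp hab.le, hj]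
    have hjb := abs_le_thetaExp hab j
    rw [hjd, abs_le] at hjb
    have hcast : (((j + N).toNat : ℕ) : ℤ) - N = j := by omega
    rw [sum_eq_single_of_mem (j + N).toNat (by rw [mem_range]; omega), hcast, if_pos hjd]
    intro k _ hk
    rw [if_neg]
    intro hkd
    have := thetaExp_injective hb hab (hkd.trans hjd.symm)
    omega
  · refine sum_eq_zero fun k _ => if_neg fun hk => h ⟨(k : ℤ) - N, ?_⟩
    rw [← natCast_thetaExp hab.le, hk]

end TripleProduct

section EulerProduct

theorem two_eq_zero_zmod_two_powerSeries : (2 : (ZMod 2)⟦X⟧) = 0 := by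
  rw [← map_ofNat (C (R := ZMod 2)) 2, show (OfNat.ofNat 2 : ZMod 2) = 0 from rfl, map_zero]

theorem one_add_eq_one_sub (y : (ZMod 2)⟦X⟧) : 1 + y = 1 - y := by
  linear_combination y * two_eq_zero_zmod_two_powerSeries

/-- The Euler product `∏_{n ≥ 1} (1 - X ^ (k n))` modulo 2. -/
noncomputable def eulerProd (k : ℕ) : (ZMod 2)⟦X⟧ := ∏' n : ℕ, (1 - X ^ (k * (n + 1)))

theorem multipliable_eulerProd {k : ℕ} (hk : 0 < k) :
    Multipliable fun n : ℕ => (1 : (ZMod 2)⟦X⟧) - X ^ (k * (n + 1)) := by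
  simp_rw [sub_eq_add_neg]
  apply multipliable_one_add_of_tendsto_order_atTop_nhds_top
  refine ENat.tendsto_nhds_top_iff_natCast_lt.mpr fun n => eventually_atTop.mpr ⟨n, fun m hm => ?_⟩
  rw [order_neg, order_X_pow]
  exact_mod_cast (by nlinarith : n < k * (m + 1))

theorem tendsto_eulerProd {k : ℕ} (hk : 0 < k) :
    Tendsto (fun N => ∏ n ∈ range N, ((1 : (ZMod 2)⟦X⟧) - X ^ (k * (n + 1)))) atTop
      (𝓝 (eulerProd k)) :=
  (multipliable_eulerProd hk).hasProd.tendsto_prod_nat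

theorem tendsto_eulerProd_mul {k c : ℕ} (hk : 0 < k) (hc : 0 < c) :
    Tendsto (fun N => ∏ n ∈ range (c * N), ((1 : (ZMod 2)⟦X⟧) - X ^ (k * (n + 1)))) atTop
      (𝓝 (eulerProd k)) :=
  (tendsto_eulerProd hk).comp (tendsto_id.const_mul_atTop' hc)

theorem eulerProd_ne_zero {k : ℕ} (hk : 0 < k) : eulerProd k ≠ 0 := by
  intro h
  have h0 := ((continuous_constantCoeff (ZMod 2)).tendsto _).comp (tendsto_eulerProd hk)
  rw [h] at h0
  have h1 : (constantCoeff (R := ZMod 2)) ∘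
      (fun N => ∏ n ∈ range N, ((1 : (ZMod 2)⟦X⟧) - X ^ (k * (n + 1)))) = fun _ => 1 := by
    ext N
    simp [map_prod, hk.ne']
  rw [h1] at h0
  have := tendsto_nhds_unique h0 tendsto_const_nhds
  simp at this

theorem eulerProd_two_mul {k : ℕ} (hk : 0 < k) : eulerProd (2 * k) = eulerProd k ^ 2 := by
  refine tendsto_nhds_unique (tendsto_eulerProd (by omega)) ?_
  convert! (tendsto_eulerProd hk).pow 2 using 2 with N
  rw [← prod_pow]
  refine prod_congr rfl fun n _ => ?_
  rw [mul_assoc, mul_comm 2, pow_mul]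
  linear_combination (X ^ (k * (n + 1)) - (X ^ (k * (n + 1))) ^ 2) *
    two_eq_zero_zmod_two_powerSeries

theorem thetaSeries_three_one {k : ℕ} (hk : 0 < k) :
    thetaSeries (ZMod 2) (3 * k) k = eulerProd (2 * k) := by
  refine tendsto_nhds_unique (tendsto_jacobi_triple_product hk (by omega)) ?_
  convert! tendsto_eulerProd_mul (k := 2 * k) (c := 3) (by omega) (by omega) using 2 with N
  induction N with
  | zero => simp
  | succ N ih =>
    rw [show 3 * (N + 1) = 3 * N + 1 + 1 + 1 by ring]
    simp only [prod_range_succ]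
    rw [← ih]
    simp only [one_add_eq_one_sub]
    rw [show 3 * k * (2 * N + 1) - k = 2 * k * (3 * N + 1) from
        Nat.sub_eq_of_eq_add (by ring),
      show 3 * k * (2 * N + 1) + k = 2 * k * (3 * N + 1 + 1) by ring,
      show 2 * (3 * k) * (N + 1) = 2 * k * (3 * N + 1 + 1 + 1) by ring]
    ring

theorem thetaSeries_two_one {k : ℕ} (hk : 0 < k) :
    thetaSeries (ZMod 2) (2 * k) k = eulerProd k ^ 3 := by
  have h : thetaSeries (ZMod 2) (2 * k) k * eulerProd (2 * k) =
      eulerProd k * eulerProd (2 * (2 * k)) := by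
    refine tendsto_nhds_unique ((tendsto_jacobi_triple_product hk (by omega)).mul
      (tendsto_eulerProd_mul (k := 2 * k) (c := 2) (by omega) (by omega))) ?_
    convert! (tendsto_eulerProd_mul (k := k) (c := 4) (by omega) (by omega)).mul
      (tendsto_eulerProd (k := 2 * (2 * k)) (by omega)) using 2 with N
    rw [← mul_assoc 2 2 k]
    induction N with
    | zero => simp
    | succ N ih =>
      rw [show 4 * (N + 1) = 4 * N + 1 + 1 + 1 + 1 by ring,
        show 2 * (N + 1) = 2 * N + 1 + 1 by ring]
      simp only [prod_range_succ]
      simp only [one_add_eq_one_sub] at ih ⊢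
      rw [show 2 * k * (2 * N + 1) - k = k * (4 * N + 1) from
          Nat.sub_eq_of_eq_add (by ring),
        show 2 * k * (2 * N + 1) + k = k * (4 * N + 1 + 1 + 1) by ring,
        show 2 * k * (2 * N + 1) = k * (4 * N + 1 + 1) by ring,
        show 2 * k * (2 * N + 1 + 1) = k * (4 * N + 1 + 1 + 1 + 1) by ring,
        show 2 * 2 * k * (N + 1) = k * (4 * N + 1 + 1 + 1 + 1) by ring]
      linear_combination (1 - X ^ (k * (4 * N + 1))) * (1 - X ^ (k * (4 * N + 1 + 1))) *
        (1 - X ^ (k * (4 * N + 1 + 1 + 1))) * (1 - X ^ (k * (4 * N + 1 + 1 + 1 + 1))) ^ 2 * ih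
  rw [eulerProd_two_mul (by omega : 0 < 2 * k), eulerProd_two_mul hk] at h
  refine mul_right_cancel₀ (pow_ne_zero 2 (eulerProd_ne_zero hk)) ?_
  linear_combination h

theorem thetaSeries_three_two_mul {k : ℕ} (hk : 0 < k) :
    thetaSeries (ZMod 2) (3 * k) (2 * k) * eulerProd k = eulerProd (3 * k) ^ 3 := by
  have h : thetaSeries (ZMod 2) (3 * k) (2 * k) * eulerProd (2 * k) * eulerProd (3 * k) =
      eulerProd k * eulerProd (2 * (3 * k)) ^ 2 := by
    refine tendsto_nhds_unique (((tendsto_jacobi_triple_product (by omega) (by omega)).mul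
      (tendsto_eulerProd_mul (k := 2 * k) (c := 3) (by omega) (by omega))).mul
      (tendsto_eulerProd_mul (k := 3 * k) (c := 2) (by omega) (by omega))) ?_
    convert! (tendsto_eulerProd_mul (k := k) (c := 6) (by omega) (by omega)).mul
      ((tendsto_eulerProd (k := 2 * (3 * k)) (by omega)).pow 2) using 2 with N
    induction N with
    | zero => simp
    | succ N ih =>
      rw [show 6 * (N + 1) = 6 * N + 1 + 1 + 1 + 1 + 1 + 1 by ring,
        show 3 * (N + 1) = 3 * N + 1 + 1 + 1 by ring,
        show 2 * (N + 1) = 2 * N + 1 + 1 by ring]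
      simp only [prod_range_succ]
      simp only [one_add_eq_one_sub] at ih ⊢
      rw [show 3 * k * (2 * N + 1) - 2 * k = k * (6 * N + 1) from
          Nat.sub_eq_of_eq_add (by ring),
        show 3 * k * (2 * N + 1) + 2 * k = k * (6 * N + 1 + 1 + 1 + 1 + 1) by ring,
        show 3 * k * (2 * N + 1) = k * (6 * N + 1 + 1 + 1) by ring,
        show 3 * k * (2 * N + 1 + 1) = k * (6 * N + 1 + 1 + 1 + 1 + 1 + 1) by ring,
        show 2 * k * (3 * N + 1) = k * (6 * N + 1 + 1) by ring,
        show 2 * k * (3 * N + 1 + 1) = k * (6 * N + 1 + 1 + 1 + 1) by ring,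
        show 2 * k * (3 * N + 1 + 1 + 1) = k * (6 * N + 1 + 1 + 1 + 1 + 1 + 1) by ring,
        show 2 * (3 * k) * (N + 1) = k * (6 * N + 1 + 1 + 1 + 1 + 1 + 1) by ring]
      linear_combination (1 - X ^ (k * (6 * N + 1))) * (1 - X ^ (k * (6 * N + 1 + 1))) *
        (1 - X ^ (k * (6 * N + 1 + 1 + 1))) * (1 - X ^ (k * (6 * N + 1 + 1 + 1 + 1))) *
        (1 - X ^ (k * (6 * N + 1 + 1 + 1 + 1 + 1))) *
        (1 - X ^ (k * (6 * N + 1 + 1 + 1 + 1 + 1 + 1))) ^ 3 * ih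
  rw [eulerProd_two_mul (by omega : 0 < 3 * k), eulerProd_two_mul hk] at h
  refine mul_right_cancel₀ (mul_ne_zero (eulerProd_ne_zero hk)
    (eulerProd_ne_zero (by omega : 0 < 3 * k))) ?_
  linear_combination h

end EulerProduct

section EvenPart

/-- The series `∑ c(2n) X ^ n` attached to `∑ c(n) X ^ n`. -/
noncomputable def evenPart {R : Type*} [Semiring R] (φ : R⟦X⟧) : R⟦X⟧ :=
  PowerSeries.mk fun n => coeff (2 * n) φ

theorem evenPart_expand_mul {R : Type*} [CommRing R] (φ ψ : R⟦X⟧) :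
    evenPart (expand 2 two_ne_zero φ * ψ) = φ * evenPart ψ := by
  have hψ : ψ = expand 2 two_ne_zero (evenPart ψ) +
      X * expand 2 two_ne_zero (PowerSeries.mk fun n => coeff (2 * n + 1) ψ) := by
    ext n
    rcases Nat.even_or_odd' n with ⟨m, rfl | rfl⟩
    · rw [map_add, coeff_expand_mul, evenPart, coeff_mk]
      rcases m with _ | m
      · simp
      · rw [show 2 * (m + 1) = 2 * m + 1 + 1 by ring, coeff_succ_X_mul,
          coeff_expand_of_not_dvd _ _ _ (by omega), add_zero]
    · rw [map_add, coeff_succ_X_mul, coeff_expand_mul, coeff_mk,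
        coeff_expand_of_not_dvd _ _ _ (by omega), zero_add]
  ext n
  nth_rewrite 1 [hψ]
  rw [evenPart, coeff_mk, mul_add, mul_left_comm, ← map_mul, ← map_mul, map_add, coeff_expand_mul]
  rcases n with _ | n
  · simp
  · rw [show 2 * (n + 1) = 2 * n + 1 + 1 by ring, coeff_succ_X_mul,
      coeff_expand_of_not_dvd _ _ _ (by omega), add_zero]

theorem expand_two_eq_sq (φ : (ZMod 2)⟦X⟧) : expand 2 two_ne_zero φ = φ ^ 2 := by
  have h := MvPowerSeries.map_frobenius_expand (σ := Unit) (R := ZMod 2) 2 two_ne_zero (f := φ)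
  rwa [ZMod.frobenius_zmod, MvPowerSeries.map_id] at h

theorem evenPart_sq_mul (φ ψ : (ZMod 2)⟦X⟧) : evenPart (φ ^ 2 * ψ) = φ * evenPart ψ := by
  rw [← expand_two_eq_sq, evenPart_expand_mul]

theorem evenPart_sq (φ : (ZMod 2)⟦X⟧) : evenPart (φ ^ 2) = φ := by
  rw [← expand_two_eq_sq]
  ext n
  rw [evenPart, coeff_mk, coeff_expand_mul]

theorem eulerProd_eq_evenPart {k : ℕ} (hk : 0 < k) :
    eulerProd k = evenPart (thetaSeries (ZMod 2) (3 * k) k) := by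
  rw [thetaSeries_three_one hk, eulerProd_two_mul hk, evenPart_sq]

end EvenPart

section ThreeRegular

theorem b3_eq_card_countRestricted (n : ℕ) : b3 n = #(Nat.Partition.countRestricted n 3) := by
  rw [← Nat.Partition.card_restricted_eq_card_countRestricted n (by norm_num : 0 < 3), b3,
    Nat.card_eq_fintype_card, Fintype.card_subtype, Nat.Partition.restricted]

/-- The generating function of `b3` modulo 2. -/
noncomputable def b3Series : (ZMod 2)⟦X⟧ := PowerSeries.mk fun n => (b3 n : ZMod 2)

theorem b3Series_mul_eulerProd : b3Series * eulerProd 1 = eulerProd 3 := by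
  have h := (Nat.Partition.hasProd_powerSeriesMk_card_countRestricted (ZMod 2)
    (by norm_num : 0 < 3)).tendsto_prod_nat
  simp_rw [← b3_eq_card_countRestricted] at h
  refine tendsto_nhds_unique (h.mul (tendsto_eulerProd one_pos)) ?_
  convert! tendsto_eulerProd (by norm_num : 0 < 3) using 2 with N
  rw [← prod_mul_distrib]
  refine prod_congr rfl fun n _ => ?_
  simp_rw [pow_mul]
  rw [pow_one, geom_sum_mul_neg, ← pow_mul, ← pow_mul, mul_comm 3]

theorem b3Series_mul_sq : eulerProd 3 ^ 2 * b3Series = thetaSeries (ZMod 2) 3 2 := by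
  have h := thetaSeries_three_two_mul one_pos
  simp only [mul_one] at h
  refine mul_right_cancel₀ (eulerProd_ne_zero one_pos) ?_
  linear_combination eulerProd 3 ^ 2 * b3Series_mul_eulerProd - h

theorem evenPart_thetaSeries_three_two :
    evenPart (thetaSeries (ZMod 2) 3 2) = thetaSeries (ZMod 2) 6 2 := by
  ext n
  rw [evenPart, coeff_mk, coeff_thetaSeries, coeff_thetaSeries]
  congr 1
  refine propext ⟨?_, ?_⟩
  · rintro ⟨j, hj⟩
    push_cast at hj
    rcases Int.even_or_odd' j with ⟨i, rfl | rfl⟩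
    · exact ⟨i, by push_cast; linarith⟩
    · ring_nf at hj
      omega
  · rintro ⟨i, hi⟩
    push_cast at hi
    exact ⟨2 * i, by push_cast; linarith⟩

theorem evenPart_b3Series_mul : evenPart b3Series * eulerProd 3 = eulerProd 1 ^ 4 := by
  have h1 : eulerProd 3 * evenPart b3Series = thetaSeries (ZMod 2) 6 2 := by
    rw [← evenPart_sq_mul, b3Series_mul_sq, evenPart_thetaSeries_three_two]
  have h2 := thetaSeries_three_one two_pos
  have h3 := eulerProd_two_mul one_pos
  rw [eulerProd_two_mul two_pos] at h2
  norm_num at h2 h3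
  rw [h3] at h2
  linear_combination h1 + h2

theorem coeff_eulerProd {k : ℕ} (hk : 0 < k) (n : ℕ)
    [Decidable (∃ j : ℤ, k * (3 * j ^ 2 + j) = 2 * n)] :
    coeff n (eulerProd k) = if ∃ j : ℤ, k * (3 * j ^ 2 + j) = 2 * n then 1 else 0 := by
  rw [eulerProd_eq_evenPart hk, evenPart, coeff_mk, coeff_thetaSeries]
  congr 1
  push_cast
  simp only [mul_add, mul_assoc, mul_left_comm (k : ℤ)]

/-- The 3-dissection of `∏ (1 - X ^ n) ^ 3` modulo 2. -/
theorem eulerProd_one_cube : eulerProd 1 ^ 3 = eulerProd 3 + X * eulerProd 9 ^ 3 := by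
  classical
  rw [← thetaSeries_two_one one_pos, ← thetaSeries_two_one (by norm_num : 0 < 9)]
  ext n
  rw [map_add, coeff_eulerProd (by norm_num), coeff_thetaSeries]
  have hL : (∃ j : ℤ, ((2 * 1 : ℕ) : ℤ) * j ^ 2 + ((1 : ℕ) : ℤ) * j = n) ↔
      (∃ j : ℤ, ((3 : ℕ) : ℤ) * (3 * j ^ 2 + j) = 2 * n) ∨
        ∃ j : ℤ, 18 * j ^ 2 + 9 * j + 1 = n := by
    push_cast
    constructor
    · rintro ⟨j, hj⟩
      obtain ⟨i, rfl | rfl | rfl⟩ : ∃ i, j = 3 * i ∨ j = 3 * i + 1 ∨ j = 3 * i - 1 :=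
        ⟨(j + 1) / 3, by omega⟩
      · exact Or.inl ⟨2 * i, by linarith⟩
      · exact Or.inl ⟨-2 * i - 1, by linarith⟩
      · exact Or.inr ⟨-i, by linarith⟩
    · rintro (⟨j, hj⟩ | ⟨j, hj⟩)
      · rcases Int.even_or_odd' j with ⟨i, rfl | rfl⟩
        · exact ⟨3 * i, by linarith⟩
        · exact ⟨-3 * i - 2, by linarith⟩
      · exact ⟨-3 * j - 1, by linarith⟩
  have hR : coeff n (X * thetaSeries (ZMod 2) (2 * 9) 9) =
      if ∃ j : ℤ, 18 * j ^ 2 + 9 * j + 1 = n then 1 else 0 := by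
    rcases n with _ | n
    · rw [coeff_zero_X_mul, if_neg]
      rintro ⟨j, hj⟩
      push_cast at hj
      omega
    · rw [coeff_succ_X_mul, coeff_thetaSeries]
      congr 1
      push_cast
      simp
  rw [hR]
  by_cases h1 : ∃ j : ℤ, ((3 : ℕ) : ℤ) * (3 * j ^ 2 + j) = 2 * n
  · have h2 : ¬ ∃ j : ℤ, 18 * j ^ 2 + 9 * j + 1 = n := by
      rintro ⟨i, hi⟩
      obtain ⟨j, hj⟩ := h1
      push_cast at hj
      omega
    rw [if_pos (hL.2 (Or.inl h1)), if_pos h1, if_neg h2, add_zero]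
  · by_cases h2 : ∃ j : ℤ, 18 * j ^ 2 + 9 * j + 1 = n
    · rw [if_pos (hL.2 (Or.inr h2)), if_neg h1, if_pos h2, zero_add]
    · rw [if_neg (fun h => (hL.1 h).elim h1 h2), if_neg h1, if_neg h2, add_zero]

theorem evenPart_b3Series_eq :
    evenPart b3Series = eulerProd 1 + eulerProd 1 * (X * thetaSeries (ZMod 2) 9 6) := by
  have h : thetaSeries (ZMod 2) 9 6 * eulerProd 3 = eulerProd 9 ^ 3 := by
    simpa using thetaSeries_three_two_mul (k := 3) (by norm_num)
  refine mul_right_cancel₀ (eulerProd_ne_zero (by norm_num : 0 < 3)) ?_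
  linear_combination evenPart_b3Series_mul + eulerProd 1 * eulerProd_one_cube -
    eulerProd 1 * X * h

open Classical in
theorem coeff_X_mul_thetaSeries_nine_six (n : ℕ) :
    coeff n (X * thetaSeries (ZMod 2) 9 6) = if ∃ j : ℤ, (3 * j + 1) ^ 2 = n then 1 else 0 := by
  rcases n with _ | n
  · rw [coeff_zero_X_mul, if_neg]
    rintro ⟨j, hj⟩
    push_cast at hj
    have := pow_eq_zero_iff (two_ne_zero) |>.1 hj
    omega
  · rw [coeff_succ_X_mul, coeff_thetaSeries]
    congr 1
    push_cast
    refine propext (exists_congr fun j => ⟨fun h => ?_, fun h => ?_⟩) <;> linarith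

/-- The normalised representations `M = x² + 6 y²` with `x ≡ 1` and `y ≡ 2` modulo 6. -/
noncomputable def normalizedReps (M : ℕ) : Finset (ℤ × ℤ) :=
  {v ∈ Icc (-M : ℤ) M ×ˢ Icc (-M : ℤ) M |
    v.1 ^ 2 + 6 * v.2 ^ 2 = M ∧ v.1 % 6 = 1 ∧ v.2 % 6 = 2}

theorem mem_normalizedReps {M : ℕ} {v : ℤ × ℤ} :
    v ∈ normalizedReps M ↔ v.1 ^ 2 + 6 * v.2 ^ 2 = M ∧ v.1 % 6 = 1 ∧ v.2 % 6 = 2 := by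
  rw [normalizedReps, mem_filter, and_iff_right_iff_imp, mem_product, mem_Icc, mem_Icc]
  rintro ⟨h, -, -⟩
  have habs (x : ℤ) : |x| ≤ x ^ 2 := by
    rw [← Int.natCast_natAbs]
    exact Int.natAbs_le_self_sq x
  exact ⟨abs_le.1 (by nlinarith [sq_nonneg v.2, habs v.1]),
    abs_le.1 (by nlinarith [sq_nonneg v.1, habs v.2])⟩

theorem even_three_mul_sq_add (j : ℤ) : Even (3 * j ^ 2 + j) := by
  rw [Int.even_add, Int.even_mul, Int.even_pow' two_ne_zero]
  exact ⟨fun h => h.resolve_left (by decide), Or.inr⟩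

theorem b3_two_mul_eq_card_normalizedReps (m : ℕ) (hm : ¬ IsSquare (24 * (m : ℤ) + 1)) :
    (b3 (2 * m) : ZMod 2) = #(normalizedReps (24 * m + 1)) := by
  classical
  have h := congrArg (coeff m) evenPart_b3Series_eq
  rw [evenPart, coeff_mk, b3Series, coeff_mk, map_add, coeff_eulerProd one_pos, if_neg, zero_add,
    coeff_mul] at h
  swap
  · rintro ⟨j, hj⟩
    push_cast at hj
    exact hm ⟨6 * j + 1, by linarith⟩
  simp_rw [coeff_eulerProd one_pos, coeff_X_mul_thetaSeries_nine_six, ite_zero_mul_ite_zero,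
    mul_one] at h
  rw [h, ← Finset.sum_filter, Finset.sum_const, nsmul_eq_mul, mul_one]
  congr 1
  have key (a b : ℤ) (hv : (a, b) ∈ normalizedReps (24 * m + 1)) :
      24 * (((a ^ 2 - 1) / 24).toNat : ℤ) = a ^ 2 - 1 ∧ 4 * ((b ^ 2 / 4).toNat : ℤ) = b ^ 2 := by
    obtain ⟨-, h2, h3⟩ := mem_normalizedReps.1 hv
    obtain ⟨j, rfl⟩ : ∃ j, a = 6 * j + 1 := ⟨a / 6, by dsimp only at h2; omega⟩
    obtain ⟨i, rfl⟩ : ∃ i, b = 6 * i + 2 := ⟨b / 6, by dsimp only at h3; omega⟩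
    obtain ⟨u, hu⟩ := even_three_mul_sq_add j
    have ha : (6 * j + 1) ^ 2 - 1 = 24 * u := by linarith
    have hb : (6 * i + 2) ^ 2 = 4 * (3 * i + 1) ^ 2 := by ring
    have hu0 : 0 ≤ u := by nlinarith [sq_nonneg j, Int.le_self_sq (-j)]
    have hv0 := sq_nonneg (3 * i + 1)
    rw [ha, hb]
    constructor <;> omega
  symm
  refine card_bij (fun v _ => (((v.1 ^ 2 - 1) / 24).toNat, (v.2 ^ 2 / 4).toNat)) ?_ ?_ ?_
  · rintro ⟨a, b⟩ hv
    obtain ⟨ha, hb⟩ := key a b hv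
    obtain ⟨h1, h2, h3⟩ := mem_normalizedReps.1 hv
    push_cast at h1
    simp only [mem_filter, HasAntidiagonal.mem_antidiagonal]
    refine ⟨by zify; linarith, ⟨a / 6, ?_⟩, b / 6, ?_⟩
    · obtain ⟨j, rfl⟩ : ∃ j, a = 6 * j + 1 := ⟨a / 6, by dsimp only at h2; omega⟩
      rw [show (6 * j + 1) / 6 = j by omega]
      push_cast
      linarith
    · obtain ⟨i, rfl⟩ : ∃ i, b = 6 * i + 2 := ⟨b / 6, by dsimp only at h3; omega⟩
      rw [show (6 * i + 2) / 6 = i by omega]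
      linarith
  · rintro ⟨a, b⟩ hv ⟨a', b'⟩ hv' h
    obtain ⟨ha, hb⟩ := key a b hv
    obtain ⟨ha', hb'⟩ := key a' b' hv'
    obtain ⟨-, h2, h3⟩ := mem_normalizedReps.1 hv
    obtain ⟨-, h2', h3'⟩ := mem_normalizedReps.1 hv'
    simp only [Prod.mk.injEq] at h h2 h3 h2' h3' ⊢
    rw [h.1] at ha
    rw [h.2] at hb
    have hab : a = a' ∨ a = -a' := sq_eq_sq_iff_eq_or_eq_neg.1 (by linarith)
    have hbb : b = b' ∨ b = -b' := sq_eq_sq_iff_eq_or_eq_neg.1 (by linarith)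
    omega
  · rintro ⟨u, v⟩ h
    simp only [mem_filter, HasAntidiagonal.mem_antidiagonal] at h
    obtain ⟨h1, ⟨j, hj⟩, i, hi⟩ := h
    push_cast at hj
    refine ⟨(6 * j + 1, 6 * i + 2), mem_normalizedReps.2 ⟨?_, by omega, by omega⟩, ?_⟩
    · push_cast
      rw [← h1]
      push_cast
      linarith
    · rw [show (6 * j + 1) ^ 2 - 1 = 24 * (u : ℤ) by linarith,
        show (6 * i + 2) ^ 2 = 4 * (v : ℤ) by linarith]
      ext <;> dsimp only <;> omega

end ThreeRegular

section Reflection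

variable {A B X Y p : ℤ}

/-- The lattice reflection attached to `p = A X ^ 2 + 9 B Y ^ 2` with `A B = 6`: it writes
`x ^ 2 + 6 y ^ 2` as `(A X ^ 2 + 9 B Y ^ 2) (A e ^ 2 + B d ^ 2)` and replaces `Y` by `-Y`. -/
def reflect (A B X Y p : ℤ) (v : ℤ × ℤ) : ℤ × ℤ :=
  (A * ((X * v.1 + 3 * B * Y * v.2) / p) * X + 3 * B * ((A * X * v.2 - 3 * Y * v.1) / p) * Y,
    ((A * X * v.2 - 3 * Y * v.1) / p) * X - 3 * ((X * v.1 + 3 * B * Y * v.2) / p) * Y)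

theorem exists_reflect_eq (hp : Prime p) (hpB : ¬ p ∣ 3 * B) (hpY : ¬ p ∣ Y)
    (h : p = A * X ^ 2 + 9 * B * Y ^ 2) {v : ℤ × ℤ} (hv : p ∣ X * v.1 + 3 * B * Y * v.2) :
    ∃ e d : ℤ, v = (A * e * X - 3 * B * d * Y, d * X + 3 * e * Y) ∧
      reflect A B X Y p v = (A * e * X + 3 * B * d * Y, d * X - 3 * e * Y) := by
  have hp0 := hp.ne_zero
  obtain ⟨a, b⟩ := v
  dsimp only at hv
  obtain ⟨e, he⟩ := hv
  obtain ⟨d, hd⟩ : p ∣ A * X * b - 3 * Y * a := by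
    have h1 : p ∣ 3 * B * Y * (A * X * b - 3 * Y * a) :=
      ⟨A * X * e - a, by linear_combination A * X * he + a * h⟩
    exact ((hp.dvd_or_dvd h1).resolve_left fun h2 => (hp.dvd_or_dvd h2).elim hpB hpY)
  refine ⟨e, d, Prod.ext (mul_left_cancel₀ hp0 ?_) (mul_left_cancel₀ hp0 ?_), ?_⟩
  · linear_combination a * h + A * X * he - 3 * B * Y * hd
  · linear_combination b * h + X * hd + 3 * Y * he
  · rw [reflect, he, hd, Int.mul_ediv_cancel_left _ hp0, Int.mul_ediv_cancel_left _ hp0]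

theorem reflect_spec (hp : Prime p) (hpB : ¬ p ∣ 3 * B) (hpY : ¬ p ∣ Y) (hAB : A * B = 6)
    (h : p = A * X ^ 2 + 9 * B * Y ^ 2) {v w : ℤ × ℤ} (hv : p ∣ X * v.1 + 3 * B * Y * v.2)
    (hw : reflect A B X Y p v = w) :
    w.1 ^ 2 + 6 * w.2 ^ 2 = v.1 ^ 2 + 6 * v.2 ^ 2 ∧ w.1 % 6 = v.1 % 6 ∧ w.2 % 6 = v.2 % 6 ∧
      p ∣ X * w.1 - 3 * B * Y * w.2 ∧ reflect A B X (-Y) p w = v ∧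
      (w = v → v.1 ^ 2 + 6 * v.2 ^ 2 = 0) := by
  obtain ⟨e, d, rfl, h2⟩ := exists_reflect_eq hp hpB hpY h hv
  rw [h2] at hw
  subst hw
  have hp0 := hp.ne_zero
  have he : X * (A * e * X + 3 * B * d * Y) - 3 * B * Y * (d * X - 3 * e * Y) = p * e := by
    linear_combination -e * h
  have hd : A * X * (d * X - 3 * e * Y) - 3 * -Y * (A * e * X + 3 * B * d * Y) = p * d := by
    linear_combination -d * h
  refine ⟨?_, ?_, ?_, ⟨e, he⟩, ?_, fun h0 => ?_⟩
  · linear_combination (12 * e * d * X * Y) * hAB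
  · exact Int.emod_eq_emod_iff_emod_sub_eq_zero.2 <| Int.emod_eq_zero_of_dvd ⟨B * d * Y, by ring⟩
  · exact Int.emod_eq_emod_iff_emod_sub_eq_zero.2 <| Int.emod_eq_zero_of_dvd ⟨-(e * Y), by ring⟩
  · rw [reflect, hd, show X * (A * e * X + 3 * B * d * Y) + 3 * B * -Y * (d * X - 3 * e * Y) = p * e
      by linear_combination he, Int.mul_ediv_cancel_left _ hp0, Int.mul_ediv_cancel_left _ hp0]
    ext <;> dsimp only <;> ring
  · rw [Prod.mk.injEq] at h0
    have hY0 : Y ≠ 0 := fun hY => hpY (hY ▸ dvd_zero p)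
    have hB0 : B ≠ 0 := fun hB => hpB (by simp [hB])
    have he0 : e = 0 := by
      have : e * Y = 0 := by linarith [h0.2]
      exact (mul_eq_zero.1 this).resolve_right hY0
    have hd0 : d = 0 := by
      have : B * d * Y = 0 := by linarith [h0.1]
      exact ((mul_eq_zero.1 ((mul_eq_zero.1 this).resolve_right hY0))).resolve_left hB0
    simp [he0, hd0]

theorem card_normalizedReps_eq_zero {M : ℕ} (hp : Prime p) (hp2 : ¬ p ∣ 2) (hp3 : ¬ p ∣ 3)
    (hAB : A * B = 6) (hX : ¬ p ∣ X) (hY : ¬ p ∣ Y) (h : p = A * X ^ 2 + 9 * B * Y ^ 2)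
    (hM : p ∣ M) (hM2 : ¬ p ^ 2 ∣ M) : (#(normalizedReps M) : ZMod 2) = 0 := by
  have hB : ¬ p ∣ 3 * B := fun hB => (hp.dvd_or_dvd hB).elim hp3 fun h6 => by
    have h23 : p ∣ 2 * 3 := (h6.mul_left A).trans (by rw [hAB]; norm_num)
    exact (hp.dvd_or_dvd h23).elim hp2 hp3
  have hY' : ¬ p ∣ -Y := by rwa [dvd_neg]
  have h' : p = A * X ^ 2 + 9 * B * (-Y) ^ 2 := by rw [h]; ring
  have hone {v : ℤ × ℤ} (hv : v.1 ^ 2 + 6 * v.2 ^ 2 = M) (hv' : ¬ p ∣ X * v.1 + 3 * B * Y * v.2) :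
      p ∣ X * v.1 + 3 * B * -Y * v.2 := by
    obtain ⟨k, hk⟩ := hM
    refine (hp.dvd_or_dvd (?_ : p ∣ (X * v.1 + 3 * B * Y * v.2) * _)).resolve_left hv'
    exact ⟨X ^ 2 * k - B * v.2 ^ 2, by
      linear_combination X ^ 2 * (hv + hk) + X ^ 2 * v.2 ^ 2 * hAB + B * v.2 ^ 2 * h⟩
  have hboth {v : ℤ × ℤ} (hv : v.1 ^ 2 + 6 * v.2 ^ 2 = M)
      (hv' : p ∣ X * v.1 - 3 * B * Y * v.2) : ¬ p ∣ X * v.1 + 3 * B * Y * v.2 := by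
    intro hv''
    have h1 : p ∣ 2 * X * v.1 := by
      rw [show 2 * X * v.1 = (X * v.1 - 3 * B * Y * v.2) + (X * v.1 + 3 * B * Y * v.2) by ring]
      exact dvd_add hv' hv''
    have h2 : p ∣ v.1 := (hp.dvd_or_dvd h1).resolve_left fun h => (hp.dvd_or_dvd h).elim hp2 hX
    have h3 : p ∣ 3 * B * Y * v.2 := (dvd_add_right (h2.mul_left X)).1 hv''
    have h4 : p ∣ v.2 := (hp.dvd_or_dvd h3).resolve_left fun h => (hp.dvd_or_dvd h).elim hB hY
    exact hM2 (hv ▸ dvd_add (pow_dvd_pow_of_dvd h2 2) ((pow_dvd_pow_of_dvd h4 2).mul_left 6))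
  have hM0 : (M : ℤ) ≠ 0 := fun h0 => hM2 (h0 ▸ dvd_zero _)
  let g : ℤ × ℤ → ℤ × ℤ := fun v =>
    if p ∣ X * v.1 + 3 * B * Y * v.2 then reflect A B X Y p v else reflect A B X (-Y) p v
  have hg {v : ℤ × ℤ} (hv : v ∈ normalizedReps M) :
      g v ∈ normalizedReps M ∧ g (g v) = v ∧ g v ≠ v := by
    rw [mem_normalizedReps] at hv ⊢
    by_cases hdvd : p ∣ X * v.1 + 3 * B * Y * v.2
    · have hgv : g v = reflect A B X Y p v := if_pos hdvd
      obtain ⟨h1, h2, h3, h4, h5, h6⟩ := reflect_spec hp hB hY hAB h hdvd hgv.symm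
      rw [← h1] at hv
      refine ⟨⟨hv.1, h2 ▸ hv.2.1, h3 ▸ hv.2.2⟩, ?_, fun h0 => hM0 ?_⟩
      · rwa [show g (g v) = reflect A B X (-Y) p (g v) from if_neg (hboth hv.1 h4)]
      · rw [← hv.1, h1, h6 h0]
    · have hgv : g v = reflect A B X (-Y) p v := if_neg hdvd
      obtain ⟨h1, h2, h3, h4, h5, h6⟩ := reflect_spec hp hB hY' hAB h' (hone hv.1 hdvd) hgv.symm
      rw [← h1] at hv
      refine ⟨⟨hv.1, h2 ▸ hv.2.1, h3 ▸ hv.2.2⟩, ?_, fun h0 => hM0 ?_⟩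
      · rw [show X * (g v).1 - 3 * B * -Y * (g v).2 = X * (g v).1 + 3 * B * Y * (g v).2 by ring] at h4
        rwa [show g (g v) = reflect A B X Y p (g v) from if_pos h4, ← neg_neg Y]
      · rw [← hv.1, h1, h6 h0]
  rw [card_eq_sum_ones, Nat.cast_sum]
  exact sum_involution (fun v _ => g v) (fun _ _ => by decide) (fun _ hv _ => (hg hv).2.2)
    (fun _ hv => (hg hv).1) (fun _ hv => (hg hv).2.1)

end Reflection

theorem exists_form {p : ℕ} (hP : ∃ j ∈ ({1, 4, 8} : Set ℤ), ∃ x y : ℤ,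
    Int.gcd x y = 1 ∧ x ^ 2 + 216 * y ^ 2 = j * p) :
    ∃ A B X Y : ℤ, 0 < A ∧ 0 < B ∧ A * B = 6 ∧ (p : ℤ) = A * X ^ 2 + 9 * B * Y ^ 2 := by
  obtain ⟨j, hj, x, y, -, h⟩ := hP
  have heven {z : ℤ} (hz : Even (z ^ 2)) : ∃ w, z = 2 * w := by
    rwa [Int.even_pow' two_ne_zero, even_iff_exists_two_mul] at hz
  obtain rfl | rfl | rfl : j = 1 ∨ j = 4 ∨ j = 8 := by simpa using hj
  · exact ⟨1, 6, x, 2 * y, by norm_num, by norm_num, by norm_num, by linarith⟩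
  · obtain ⟨w, rfl⟩ := heven (z := x) ⟨2 * p - 108 * y ^ 2, by linarith⟩
    exact ⟨1, 6, w, y, by norm_num, by norm_num, by norm_num, by linarith⟩
  · obtain ⟨w, rfl⟩ := heven (z := x) ⟨4 * p - 108 * y ^ 2, by linarith⟩
    obtain ⟨z, rfl⟩ := heven (z := w) ⟨p - 27 * y ^ 2, by linarith⟩
    exact ⟨2, 3, z, y, by norm_num, by norm_num, by norm_num, by linarith⟩

theorem not_sq_dvd_of_ne_div {p : ℕ} (hp : p.Prime) (hp2 : p ≠ 2) (hp3 : p ≠ 3) {n α t : ℕ} (hα : α < p)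
    (hα' : α ≠ p / 24) (ht : t < p) (hdvd : p ∣ 24 * t + 1) :
    ¬ p ^ 2 ∣ 24 * (p ^ 2 * n + p * α + t) + 1 := by
  intro h
  obtain ⟨s, hs⟩ := hdvd
  have h24 : Nat.Coprime p 24 := by
    rw [show 24 = 2 ^ 3 * 3 by norm_num]
    exact (((Nat.coprime_primes hp Nat.prime_two).2 hp2).pow_right 3).mul_right
      ((Nat.coprime_primes hp Nat.prime_three).2 hp3)
  have hs24 : s < 24 := by
    by_contra! hs24
    nlinarith
  have hsp : p % 24 = s := by
    have h1 : p % 24 * (s % 24) % 24 = 1 := by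
      rw [← Nat.mul_mod, ← hs]
      omega
    rw [Nat.mod_eq_of_lt hs24] at h1
    have h2 : p % 24 < 24 := Nat.mod_lt _ (by norm_num)
    generalize p % 24 = r at h1 h2
    clear hs
    interval_cases r <;> omega
  have h1 : p ∣ 24 * α + s := by
    rw [show 24 * (p ^ 2 * n + p * α + t) + 1 = p ^ 2 * (24 * n) + p * (24 * α + s) by
      linear_combination hs, Nat.dvd_add_right (dvd_mul_right _ _), sq] at h
    exact Nat.dvd_of_mul_dvd_mul_left hp.pos h
  have h2 : (p : ℤ) ∣ 24 * ((α : ℤ) - (p / 24 : ℕ)) := by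
    have h3 := dvd_sub (Int.natCast_dvd_natCast.2 h1) (dvd_refl (p : ℤ))
    rwa [show ((24 * α + s : ℕ) : ℤ) - p = 24 * ((α : ℤ) - (p / 24 : ℕ)) by
      push_cast
      omega] at h3
  have h4 : (p : ℤ) ∣ (α : ℤ) - (p / 24 : ℕ) :=
    IsCoprime.dvd_of_dvd_mul_left (Nat.isCoprime_iff_coprime.2 h24) h2
  have h5 := Int.eq_zero_of_abs_lt_dvd h4 (by rw [abs_lt]; omega)
  omega

theorem stmt0 (p : ℕ) (hp : p.Prime)
    (hP : ∃ j ∈ ({1, 4, 8} : Set ℤ), ∃ x y : ℤ,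
      Int.gcd x y = 1 ∧ x ^ 2 + 216 * y ^ 2 = j * p)
    (n α t : ℕ) (hα : α < p) (hα' : α ≠ p / 24)
    (ht1 : 1 ≤ t) (ht2 : t ≤ p - 1) (ht3 : (24 * t : ℤ) ≡ -1 [ZMOD (p : ℤ)]) :
    2 ∣ b3 (2 * (p ^ 2 * n + p * α + t)) := by
  have hpZ : Prime (p : ℤ) := Nat.prime_iff_prime_int.1 hp
  have hpos : (0 : ℤ) < p := mod_cast hp.pos
  have hdvd : p ∣ 24 * t + 1 := by
    zify
    simpa using ht3.symm.dvd
  have hp2 : p ≠ 2 := by rintro rfl; omega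
  have hp3 : p ≠ 3 := by rintro rfl; omega
  have hp2' : ¬ (p : ℤ) ∣ 2 := fun h =>
    hp2 ((Nat.prime_dvd_prime_iff_eq hp Nat.prime_two).1 (mod_cast h))
  have hp3' : ¬ (p : ℤ) ∣ 3 := fun h =>
    hp3 ((Nat.prime_dvd_prime_iff_eq hp Nat.prime_three).1 (mod_cast h))
  have hsq := not_sq_dvd_of_ne_div hp hp2 hp3 (n := n) hα hα' (by omega) hdvd
  set m := p ^ 2 * n + p * α + t with hm
  have hM : (p : ℤ) ∣ (24 * m + 1 : ℕ) := by
    rw [Int.natCast_dvd_natCast, hm, show 24 * (p ^ 2 * n + p * α + t) + 1 =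
      p * (24 * (p * n + α)) + (24 * t + 1) by ring]
    exact (dvd_mul_right _ _).add hdvd
  have hM2 : ¬ (p : ℤ) ^ 2 ∣ (24 * m + 1 : ℕ) := by exact_mod_cast hsq
  have hzero {z c : ℤ} (hc : 0 < c) (hz : (p : ℤ) ∣ z) (hle : c * z ^ 2 ≤ p) : z = 0 := by
    by_contra h0
    have h1 : (p : ℤ) ^ 2 ≤ z ^ 2 := Int.le_of_dvd (by positivity) (pow_dvd_pow_of_dvd hz 2)
    have h2 : (2 : ℤ) ≤ p := mod_cast hp.two_le
    nlinarith
  obtain ⟨A, B, X, Y, hA, hB, hAB, h⟩ := exists_form hP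
  have hX : ¬ (p : ℤ) ∣ X := fun hX => by
    have hX0 := hzero hA hX (by nlinarith [sq_nonneg Y])
    have h3 : (3 : ℤ) ∣ p := ⟨3 * B * Y ^ 2, by rw [h, hX0]; ring⟩
    exact hp3 ((Nat.prime_dvd_prime_iff_eq Nat.prime_three hp).1 (mod_cast h3)).symm
  have hY : ¬ (p : ℤ) ∣ Y := fun hY => by
    have hY0 := hzero (by linarith : 0 < 9 * B) hY (by nlinarith [sq_nonneg X])
    have h1 : (p : ℤ) ∣ A * X ^ 2 := ⟨1, by rw [mul_one, h, hY0]; ring⟩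
    refine (hpZ.dvd_or_dvd h1).elim (fun h2 => ?_) fun h2 => hX (hpZ.dvd_of_dvd_pow h2)
    have h23 : (p : ℤ) ∣ 2 * 3 := (h2.mul_right B).trans (by rw [hAB]; norm_num)
    exact (hpZ.dvd_or_dvd h23).elim hp2' hp3'
  have hns : ¬ IsSquare (24 * (m : ℤ) + 1) := by
    rintro ⟨r, hr⟩
    push_cast at hM hM2
    rw [hr, ← sq] at hM hM2
    exact hM2 (pow_dvd_pow_of_dvd (hpZ.dvd_of_dvd_pow hM) 2)
  rw [← ZMod.natCast_eq_zero_iff, b3_two_mul_eq_card_normalizedReps m hns]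
  exact card_normalizedReps_eq_zero hpZ hp2' hp3' hAB hX hY h hM hM2
end

section
/- For every prime p in 𝒫, every integer n ≥ 0, and every integer α with 0 ≤ α < p and α ≠ ⌊p/24⌋, setting s = p²n + pα + t where t is the unique integer with 1 ≤ t ≤ p−1 and 24t ≡ −1 (mod p), the number of pairs (x,y) of nonnegative integers satisfying x² + 24y² = 24s + 1 and such that y = 0 or 3 ∤ y is even. -/
theorem even_ncard_of_involution {β : Type*} (S : Set β) (f : β → β)
    (hmem : ∀ z ∈ S, f z ∈ S) (hne : ∀ z ∈ S, f z ≠ z) (hinv : ∀ z ∈ S, f (f z) = z) :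
    Even S.ncard := by
  rcases S.finite_or_infinite with hS | hS
  · have key : ∑ _z ∈ hS.toFinset, (1 : ZMod 2) = 0 :=
      Finset.sum_involution (fun z _ => f z) (fun _ _ => by decide)
        (fun z hz _ => hne z (hS.mem_toFinset.1 hz))
        (fun z hz => hS.mem_toFinset.2 (hmem z (hS.mem_toFinset.1 hz)))
        (fun z hz => hinv z (hS.mem_toFinset.1 hz))
    rw [Set.ncard_eq_toFinset_card S hS, ← ZMod.natCast_eq_zero_iff_even]
    simpa using key
  · simp [hS.ncard]

/-- Multiplication by `(x + 6y√-6)/(x - 6y√-6)` followed by conjugation, as a reflection of the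
lattice `{u + 2v√-6}`; the parameters satisfy `k * x + 54 * m * y ^ 2 = 2 * p`. -/
def reflection (p k m x y : ℤ) (z : ℤ × ℤ) : ℤ × ℤ :=
  (z.1 + 18 * m * y * ((z.2 * x - 3 * z.1 * y) / p), z.2 - k * ((z.2 * x - 3 * z.1 * y) / p))

/-- Reflection followed by the sign change which makes the first coordinate positive. -/
def posReflection (p k m x y : ℤ) (z : ℤ × ℤ) : ℤ × ℤ :=
  if 0 < (reflection p k m x y z).1 then reflection p k m x y z else -reflection p k m x y z

theorem reflection_neg {p k m x y : ℤ} {z : ℤ × ℤ} (h : p ∣ z.2 * x - 3 * z.1 * y) :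
    reflection p k m x y (-z) = -reflection p k m x y z := by
  obtain ⟨b, hb⟩ := h
  have e : -z.2 * x - 3 * -z.1 * y = -(p * b) := by linear_combination -hb
  have hneg : -(p * b) / p = -(p * b / p) := Int.neg_ediv_of_dvd (Dvd.intro b rfl)
  ext <;> simp only [reflection, Prod.fst_neg, Prod.snd_neg, hb, e, hneg] <;> ring

theorem reflection_involutive {p k m x y : ℤ} (hp : p ≠ 0) (h1 : k * x + 54 * m * y ^ 2 = 2 * p)
    {z : ℤ × ℤ} (h : p ∣ z.2 * x - 3 * z.1 * y) :
    reflection p k m x y (reflection p k m x y z) = z := by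
  obtain ⟨b, hb⟩ := h
  obtain ⟨u, v⟩ := z
  have e : (v - k * b) * x - 3 * (u + 18 * m * y * b) * y = p * (-b) := by
    linear_combination hb - b * h1
  simp only at hb
  ext <;> simp only [reflection, hb, Int.mul_ediv_cancel_left _ hp, e] <;> ring

/-- The integral solutions of `u² + 24v² = N` with `3 ∤ v` and `u > 0` which are divisible by
the prime above `p` determined by `x + 6y√-6`. -/
def posSolutions (p x y N : ℤ) : Set (ℤ × ℤ) :=
  {z | z.1 ^ 2 + 24 * z.2 ^ 2 = N ∧ ¬ 3 ∣ z.2 ∧ p ∣ z.1 * x + 72 * z.2 * y ∧ 0 < z.1}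

theorem dvd_of_dvd_add {p j x y u v : ℤ} (hp : Prime p) (h72 : IsCoprime p 72) (hy : ¬ p ∣ y)
    (hj : x ^ 2 + 216 * y ^ 2 = j * p) (h : p ∣ u * x + 72 * v * y) :
    p ∣ v * x - 3 * u * y := by
  have h' : p ∣ 72 * (y * (v * x - 3 * u * y)) := by
    obtain ⟨a, ha⟩ := h
    exact ⟨a * x - u * j, by linear_combination x * ha - u * hj⟩
  exact (hp.dvd_or_dvd (h72.dvd_of_dvd_mul_left h')).resolve_left hy

theorem even_ncard_posSolutions {p j k m x y N : ℤ} (hp : Prime p) (h72 : IsCoprime p 72)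
    (h3p : ¬ 3 ∣ p) (hy : ¬ p ∣ y) (hj : x ^ 2 + 216 * y ^ 2 = j * p)
    (h1 : k * x + 54 * m * y ^ 2 = 2 * p) (h2 : m * x = 4 * k) (hN : ¬ 3 ∣ N) :
    Even (posSolutions p x y N).ncard := by
  have h3kx : ¬ 3 ∣ k * x := by
    rintro ⟨c, hc⟩
    have : 2 * p = 3 * (c + 18 * m * y ^ 2) := by linear_combination hc - h1
    omega
  have h3k : ¬ 3 ∣ k := fun h => h3kx (h.mul_right x)
  have h3x : ¬ 3 ∣ x := fun h => h3kx (h.mul_left k)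
  have i3 : Prime (3 : ℤ) := Int.prime_three
  have hdvd : ∀ z ∈ posSolutions p x y N, p ∣ z.2 * x - 3 * z.1 * y := fun z hz =>
    dvd_of_dvd_add hp h72 hy hj hz.2.2.1
  have hu : ∀ u v : ℤ, u ^ 2 + 24 * v ^ 2 = N → ¬ 3 ∣ u := by
    rintro u v h ⟨c, rfl⟩
    exact hN ⟨3 * c ^ 2 + 8 * v ^ 2, by linear_combination -h⟩
  have hrefl : ∀ z ∈ posSolutions p x y N,
      (reflection p k m x y z).1 ^ 2 + 24 * (reflection p k m x y z).2 ^ 2 = N ∧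
      ¬ 3 ∣ (reflection p k m x y z).2 ∧
      (reflection p k m x y z).1 * x + 72 * (reflection p k m x y z).2 * y
        = z.1 * x + 72 * z.2 * y := by
    rintro ⟨u, v⟩ hz
    obtain ⟨b, hb⟩ := hdvd _ hz
    obtain ⟨e, hv, -, -⟩ := hz
    simp only at hb e hv
    simp only [reflection, hb, Int.mul_ediv_cancel_left _ hp.ne_zero]
    refine ⟨?_, ?_, ?_⟩
    · linear_combination e - 12 * m * b * hb + (12 * b * v - 6 * b ^ 2 * k) * h2
        + 6 * m * b ^ 2 * h1
    · rintro ⟨c, hc⟩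
      have : 3 ∣ p * v :=
        ⟨18 * v * m * y ^ 2 - p * c + k * u * y, by
          linear_combination -p * hc + k * hb - v * h1⟩
      rcases i3.dvd_or_dvd this with h | h
      exacts [h3p h, hv h]
    · linear_combination 18 * b * y * h2
  refine even_ncard_of_involution _ (posReflection p k m x y) ?_ ?_ ?_
  · intro z hz
    obtain ⟨e, hv, hA⟩ := hrefl z hz
    have hd := hz.2.2.1
    rw [← hA] at hd
    have h0 : (reflection p k m x y z).1 ≠ 0 := fun h => hu _ _ e (by rw [h]; exact dvd_zero 3)
    unfold posReflection
    split_ifs with hpos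
    · exact ⟨e, hv, hd, hpos⟩
    · refine ⟨by simpa using e, by simpa using hv, ?_, ?_⟩
      · obtain ⟨a, ha⟩ := hd
        exact ⟨-a, by simp only [Prod.fst_neg, Prod.snd_neg]; linear_combination -ha⟩
      · simp only [Prod.fst_neg]; omega
  · intro z hz heq
    obtain ⟨-, -, hA⟩ := hrefl z hz
    unfold posReflection at heq
    split_ifs at heq with hpos
    · obtain ⟨b, hb⟩ := hdvd _ hz
      have h := congrArg Prod.snd heq
      simp only [reflection, hb, Int.mul_ediv_cancel_left _ hp.ne_zero] at h
      have hkb : k * b = 0 := by linarith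
      have hb0 : b = 0 := (mul_eq_zero.1 hkb).resolve_left (fun h => h3k (by simp [h]))
      have : 3 ∣ z.2 * x := ⟨z.1 * y, by rw [hb0] at hb; linarith⟩
      rcases i3.dvd_or_dvd this with h | h
      exacts [hz.2.1 h, h3x h]
    · have h1 := congrArg Prod.fst heq
      have h2 := congrArg Prod.snd heq
      simp only [Prod.fst_neg, Prod.snd_neg] at h1 h2
      have : 3 ∣ z.1 * x := ⟨-24 * z.2 * y, by
        have e1 : (reflection p k m x y z).1 = -z.1 := by linarith
        have e2 : (reflection p k m x y z).2 = -z.2 := by linarith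
        rw [e1, e2] at hA
        linarith⟩
      rcases i3.dvd_or_dvd this with h | h
      exacts [hu _ _ hz.1 h, h3x h]
  · intro z hz
    have hd := hdvd z hz
    have hinv := reflection_involutive hp.ne_zero h1 hd
    have hpos := hz.2.2.2
    by_cases h : 0 < (reflection p k m x y z).1
    · have e : posReflection p k m x y z = reflection p k m x y z := if_pos h
      rw [e, posReflection, hinv, if_pos hpos]
    · have e : posReflection p k m x y z = -reflection p k m x y z := if_neg h
      have hd' : p ∣ (reflection p k m x y z).2 * x - 3 * (reflection p k m x y z).1 * y :=
        dvd_of_dvd_add hp h72 hy hj ((hrefl z hz).2.2 ▸ hz.2.2.1)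
      rw [e, posReflection, reflection_neg hd', hinv, if_neg (by simpa using hpos.le), neg_neg]

theorem ncard_natSolutions {p j x y : ℤ} {N : ℕ} (hp : Prime p) (h72 : IsCoprime p 72)
    (hy : ¬ p ∣ y) (hj : x ^ 2 + 216 * y ^ 2 = j * p) (hpN : p ∣ (N : ℤ))
    (hpN2 : ¬ p ^ 2 ∣ (N : ℤ)) :
    {z : ℕ × ℕ | z.1 ^ 2 + 24 * z.2 ^ 2 = N ∧ ¬ 3 ∣ z.2}.ncard
      = (posSolutions p x y N).ncard := by
  have hx : ¬ p ∣ x := by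
    intro h
    have : p ∣ 72 * (3 * y ^ 2) := by
      obtain ⟨c, rfl⟩ := h
      exact ⟨j - p * c ^ 2, by linear_combination hj⟩
    have h3 := h72.dvd_of_dvd_mul_left this
    have : IsCoprime p 3 := h72.of_isCoprime_of_dvd_right (by norm_num)
    exact hy (hp.dvd_of_dvd_pow (this.dvd_of_dvd_mul_left h3))
  have h24 : IsCoprime p 24 := h72.of_isCoprime_of_dvd_right (by norm_num)
  have hne : ∀ u v : ℤ, u ^ 2 + 24 * v ^ 2 = N → ¬ p ∣ u := by
    rintro u v h ⟨c, rfl⟩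
    obtain ⟨d, hd⟩ := hpN
    have h1 : p ∣ 24 * v ^ 2 := ⟨d - p * c ^ 2, by linear_combination h + hd⟩
    obtain ⟨w, rfl⟩ := hp.dvd_of_dvd_pow (h24.dvd_of_dvd_mul_left h1)
    exact hpN2 ⟨c ^ 2 + 24 * w ^ 2, by linear_combination -h⟩
  symm
  refine Set.BijOn.ncard_eq (f := fun z : ℤ × ℤ => (z.1.natAbs, z.2.natAbs)) ⟨?_, ?_, ?_⟩
  · rintro ⟨u, v⟩ ⟨e, hv, -, -⟩
    refine ⟨?_, ?_⟩
    · zify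
      simpa using e
    · simp only at hv ⊢
      omega
  · rintro ⟨u, v⟩ ⟨e, hv, hd, hu⟩ ⟨u', v'⟩ ⟨-, -, hd', hu'⟩ heq
    simp only [Prod.mk.injEq] at *
    obtain ⟨h1, h2⟩ := heq
    have huu : u = u' := by omega
    subst huu
    refine ⟨rfl, ?_⟩
    rcases Int.natAbs_eq_natAbs_iff.1 h2 with h | h
    · exact h
    · exfalso
      have : p ∣ 72 * (u * x) := by
        obtain ⟨a, ha⟩ := hd
        obtain ⟨b, hb⟩ := hd'
        subst h
        exact ⟨36 * (a + b), by linear_combination 36 * ha + 36 * hb⟩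
      rcases hp.dvd_or_dvd (h72.dvd_of_dvd_mul_left this) with h | h
      exacts [hne _ _ e h, hx h]
  · rintro ⟨u, v⟩ ⟨e, hv⟩
    simp only at e hv
    have e' : (u : ℤ) ^ 2 + 24 * (v : ℤ) ^ 2 = N := by exact_mod_cast e
    have hu0 : 0 < (u : ℤ) := by
      rcases Nat.eq_zero_or_pos u with h | h
      · exact absurd (by simp [h]) (hne _ _ e')
      · exact_mod_cast h
    have hprod : p ∣ (u * x + 72 * v * y) * (u * x + 72 * (-v) * y) := by
      obtain ⟨d, hd⟩ := hpN
      exact ⟨u ^ 2 * j - 216 * y ^ 2 * d, by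
        linear_combination (u : ℤ) ^ 2 * hj - 216 * y ^ 2 * e' - 216 * y ^ 2 * hd⟩
    rcases hp.dvd_or_dvd hprod with h | h
    · exact ⟨(u, v), ⟨e', by simp only; omega, h, hu0⟩, by simp⟩
    · exact ⟨(u, -v), ⟨by simpa using e', by simp only; omega, h, hu0⟩, by simp⟩

theorem eq_div_of_sq_dvd {p n α t : ℕ} (hp : p.Prime) (h24 : Nat.Coprime p 24) (hα : α < p)
    (ht : t < p) (hpt : p ∣ 24 * t + 1) (h : p ^ 2 ∣ 24 * (p ^ 2 * n + p * α + t) + 1) :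
    α = p / 24 := by
  obtain ⟨k, hk⟩ := hpt
  have hp0 := hp.pos
  have hk24 : k < 24 := by
    by_contra hc
    have := Nat.mul_le_mul_left p (not_lt.1 hc)
    omega
  have hr : k = p % 24 := by
    have hmod : (p % 24) * k % 24 = 1 := by
      rw [Nat.mul_mod, Nat.mod_mod, ← Nat.mul_mod, ← hk]; omega
    have hlt : p % 24 < 24 := Nat.mod_lt _ (by norm_num)
    generalize p % 24 = r at *
    interval_cases k <;> omega
  have h2 : p * p ∣ p * (24 * α + k) := by
    have e : 24 * (p ^ 2 * n + p * α + t) + 1 = p ^ 2 * (24 * n) + p * (24 * α + k) := by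
      linear_combination hk
    rw [e] at h
    rw [← pow_two]
    exact (Nat.dvd_add_right (Dvd.intro _ rfl)).1 h
  have h3 : (p : ℤ) ∣ 24 * α + k := by
    exact_mod_cast Nat.dvd_of_mul_dvd_mul_left hp0 h2
  have h4 : (p : ℤ) ∣ 24 * ((α : ℤ) - (p / 24 : ℕ)) := by
    have : (24 : ℤ) * ((α : ℤ) - (p / 24 : ℕ)) = (24 * α + k) - p := by omega
    rw [this]
    exact dvd_sub_self_right.2 h3
  have h5 : (p : ℤ) ∣ (α : ℤ) - (p / 24 : ℕ) :=
    (Nat.isCoprime_iff_coprime.2 h24).dvd_of_dvd_mul_left h4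
  have h6 := Int.eq_zero_of_abs_lt_dvd h5 (by rw [abs_lt]; omega)
  omega

theorem stmt1 (p : ℕ) (hp : p.Prime)
    (hP : ∃ j ∈ ({1, 4, 8} : Set ℤ), ∃ x y : ℤ,
      Int.gcd x y = 1 ∧ x ^ 2 + 216 * y ^ 2 = j * p)
    (n α t : ℕ) (hα : α < p) (hα' : α ≠ p / 24)
    (ht1 : 1 ≤ t) (ht2 : t ≤ p - 1) (ht3 : (24 * t : ℤ) ≡ -1 [ZMOD (p : ℤ)]) :
    Even (Set.ncard {xy : ℕ × ℕ |
      xy.1 ^ 2 + 24 * xy.2 ^ 2 = 24 * (p ^ 2 * n + p * α + t) + 1 ∧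
      (xy.2 = 0 ∨ ¬ (3 ∣ xy.2))}) := by
  obtain ⟨j, hjm, x, y, hxy, hj⟩ := hP
  have hpt : p ∣ 24 * t + 1 := by
    have h := ht3.symm.dvd
    have : (p : ℤ) ∣ ((24 * t + 1 : ℕ) : ℤ) := by push_cast; simpa using h
    exact_mod_cast this
  have hcop : Nat.Coprime p 24 := by
    refine (Nat.Prime.coprime_iff_not_dvd hp).2 fun h => hp.one_lt.ne' ?_
    exact Nat.dvd_one.1 ((Nat.dvd_add_right (h.mul_right t)).1 hpt)
  have h3 : ¬ 3 ∣ p := fun h => by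
    have := Nat.dvd_gcd h (by norm_num : 3 ∣ 24)
    rw [hcop] at this
    omega
  have hpZ : Prime (p : ℤ) := Nat.prime_iff_prime_int.1 hp
  have h72 : IsCoprime (p : ℤ) 72 := by
    refine Nat.isCoprime_iff_coprime.2 (?_ : Nat.Coprime p 72)
    exact (hcop.mul_right hcop).coprime_dvd_right (by norm_num)
  have hy : ¬ (p : ℤ) ∣ y := fun h => by
    have hx2 : (p : ℤ) ∣ x ^ 2 := by
      obtain ⟨c, rfl⟩ := h
      exact ⟨j - 216 * p * c ^ 2, by linear_combination hj⟩
    have := Int.dvd_coe_gcd (hpZ.dvd_of_dvd_pow hx2) h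
    rw [hxy] at this
    exact hpZ.not_isUnit (isUnit_of_dvd_one (by simpa using this))
  obtain ⟨k, m, h1, h2⟩ : ∃ k m : ℤ, k * x + 54 * m * y ^ 2 = 2 * p ∧ m * x = 4 * k := by
    rcases hjm with rfl | rfl | rfl
    · exact ⟨2 * x, 8, by linear_combination 2 * hj, by ring⟩
    · obtain ⟨c, rfl⟩ : 2 ∣ x := Int.prime_two.dvd_of_dvd_pow (n := 2) (by omega)
      exact ⟨c, 2, by linarith, by ring⟩
    · obtain ⟨c, rfl⟩ : 2 ∣ x := Int.prime_two.dvd_of_dvd_pow (n := 2) (by omega)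
      obtain ⟨d, rfl⟩ : 2 ∣ c := Int.prime_two.dvd_of_dvd_pow (n := 2) (by
        have : (2 * c) ^ 2 = 4 * c ^ 2 := by ring
        omega)
      exact ⟨d, 1, by linarith, by ring⟩
  set N := 24 * (p ^ 2 * n + p * α + t) + 1 with hN
  have hpN : p ∣ N := by
    have e : N = p * (24 * (p * n + α)) + (24 * t + 1) := by rw [hN]; ring
    rw [e]
    exact (Nat.dvd_add_right (Dvd.intro _ rfl)).2 hpt
  have hpN2 : ¬ p ^ 2 ∣ N := fun h =>
    hα' (eq_div_of_sq_dvd hp hcop hα (by omega) hpt h)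
  have hset : {xy : ℕ × ℕ | xy.1 ^ 2 + 24 * xy.2 ^ 2 = N ∧ (xy.2 = 0 ∨ ¬ 3 ∣ xy.2)}
      = {z : ℕ × ℕ | z.1 ^ 2 + 24 * z.2 ^ 2 = N ∧ ¬ 3 ∣ z.2} := by
    ext ⟨u, v⟩
    refine and_congr_right fun e => ⟨fun h => h.resolve_left fun h0 => ?_, Or.inr⟩
    simp only at e h0
    rw [h0] at e
    have e' : u ^ 2 = N := by simpa using e
    rw [← e'] at hpN hpN2
    exact hpN2 (pow_dvd_pow_of_dvd (hp.dvd_of_dvd_pow hpN) 2)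
  have h3N : ¬ 3 ∣ (N : ℤ) := by omega
  rw [hset, ncard_natSolutions hpZ h72 hy hj (by exact_mod_cast hpN) (by exact_mod_cast hpN2)]
  exact even_ncard_posSolutions hpZ h72 (by exact_mod_cast h3) hy hj h1 h2 h3N
end

section
/- Let m be a positive integer coprime to 6. If there exist integers x, y with gcd(x,y) = 1 and x² + 216y² = 8m, then m ≡ 5 (mod 24) or m ≡ 11 (mod 24). Moreover, for any such primitive solution (x,y): if m ≡ 5 (mod 24) then the 2-adic valuation of x equals 2, and if m ≡ 11 (mod 24) then the 2-adic valuation of x is at least 3. -/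
/-- Dividing `x ^ 2 + 216 * y ^ 2 = 8 * m` by `8` when `y` is coprime to `x`:
here `x = 4 * t` with `2 * t ^ 2 + 27 * y ^ 2 = m`, and `y` is odd. -/
theorem exists_two_mul_sq_add_eq {x y m : ℤ} (hg : Int.gcd x y = 1)
    (h : x ^ 2 + 216 * y ^ 2 = 8 * m) :
    ∃ t : ℤ, x = 4 * t ∧ 2 * t ^ 2 + 27 * y ^ 2 = m ∧ Odd y := by
  have hx : (2 : ℤ) ∣ x := by
    refine Int.prime_two.dvd_of_dvd_pow (n := 2) ⟨4 * m - 108 * y ^ 2, ?_⟩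
    linarith
  obtain ⟨s, rfl⟩ := hx
  have hs : (2 : ℤ) ∣ s := by
    refine Int.prime_two.dvd_of_dvd_pow (n := 2) ⟨m - 27 * y ^ 2, ?_⟩
    linarith
  obtain ⟨t, rfl⟩ := hs
  refine ⟨t, by ring, by linarith, ?_⟩
  by_contra hy
  have hd := Int.dvd_coe_gcd (dvd_mul_right 2 (2 * t)) (Int.not_odd_iff_even.1 hy).two_dvd
  rw [hg] at hd
  omega

/-- The residue modulo `24` of `2 * t ^ 2 + 27 * y ^ 2`, with `y` odd and `3 ∤ t`,
is determined by the parity of `t`. -/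
theorem two_mul_sq_add_emod {t y m : ℤ} (h : 2 * t ^ 2 + 27 * y ^ 2 = m)
    (hy : Odd y) (hm : ¬ (3 : ℤ) ∣ m) :
    (Odd t ∧ m % 24 = 5) ∨ (Even t ∧ m % 24 = 11) := by
  have hy8 := Int.eight_dvd_sq_sub_one_of_odd hy
  have ht3 : t ^ 2 % 3 = 1 := by
    have h3 : t % 3 = 0 ∨ t % 3 = 1 ∨ t % 3 = 2 := by omega
    rcases h3 with h3 | h3 | h3
    · have : t ^ 2 % 3 = 0 := by simp [pow_two, Int.mul_emod, h3]
      omega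
    all_goals simp [pow_two, Int.mul_emod, h3]
  rcases Int.even_or_odd t with ht | ht
  · have ht4 : (4 : ℤ) ∣ t ^ 2 := pow_dvd_pow_of_dvd ht.two_dvd 2
    exact Or.inr ⟨ht, by omega⟩
  · have ht8 := Int.eight_dvd_sq_sub_one_of_odd ht
    exact Or.inl ⟨ht, by omega⟩

theorem stmt6 (m : ℕ) (hm : 0 < m) (h6 : Nat.Coprime m 6) :
    ((∃ x y : ℤ, Int.gcd x y = 1 ∧ x ^ 2 + 216 * y ^ 2 = 8 * m) →
      (m % 24 = 5 ∨ m % 24 = 11)) ∧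
    (∀ x y : ℤ, Int.gcd x y = 1 → x ^ 2 + 216 * y ^ 2 = 8 * m →
      ((m % 24 = 5 → (Int.natAbs x).factorization 2 = 2) ∧
       (m % 24 = 11 → 3 ≤ (Int.natAbs x).factorization 2))) := by
  have h3 : ¬ (3 : ℤ) ∣ m := by
    intro hd
    have := Nat.dvd_gcd (Int.natCast_dvd_natCast.1 hd : 3 ∣ m) (by norm_num : 3 ∣ 6)
    rw [Nat.Coprime.gcd_eq_one h6] at this
    omega
  constructor
  · rintro ⟨x, y, hg, h⟩
    obtain ⟨t, -, ht, hy⟩ := exists_two_mul_sq_add_eq hg h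
    have := two_mul_sq_add_emod ht hy h3
    omega
  · intro x y hg h
    obtain ⟨t, rfl, ht, hy⟩ := exists_two_mul_sq_add_eq hg h
    have ht0 : t ≠ 0 := by
      rintro rfl
      exact h3 ⟨9 * y ^ 2, by linarith⟩
    have hx0 : (4 * t).natAbs ≠ 0 := by omega
    have le_iff (k : ℕ) : k ≤ (4 * t).natAbs.factorization 2 ↔ 2 ^ k ∣ (4 * t).natAbs :=
      (Nat.prime_two.pow_dvd_iff_le_factorization hx0).symm
    have le_two := le_iff 2
    have le_three := le_iff 3
    rcases two_mul_sq_add_emod ht hy h3 with ⟨⟨s, hs⟩, hm24⟩ | ⟨⟨s, hs⟩, hm24⟩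
    · exact ⟨fun _ => by omega, fun _ => by omega⟩
    · exact ⟨fun _ => by omega, fun _ => by omega⟩
end

section
/- For every prime p in 𝒫 there is exactly one j ∈ {1,4,8} such that x² + 216y² = jp has a primitive solution; moreover, if j = 1 then p ≡ 1 (mod 24), if j = 4 then p ≡ 7 (mod 24), and if j = 8 then p ≡ 5 or 11 (mod 24). -/
/-- `x² + 216 y² = m` has a primitive solution. -/
def HasPrimSol (m : ℤ) : Prop :=
  ∃ x y : ℤ, Int.gcd x y = 1 ∧ x ^ 2 + 216 * y ^ 2 = m

theorem le_of_hasPrimSol {m : ℤ} (hm : m ≠ 1) (h : HasPrimSol m) : 216 ≤ m := by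
  obtain ⟨x, y, hg, rfl⟩ := h
  rcases eq_or_ne y 0 with rfl | hy
  · refine absurd ?_ hm
    have hx : x.natAbs = 1 := by simpa using hg
    simp [← Int.natAbs_sq x, hx]
  · have : 0 < y ^ 2 := by positivity
    nlinarith [sq_nonneg x]

theorem prime_coprime_six_of_le {p : ℕ} (hp : p.Prime) (h : 27 ≤ p) :
    (p : ℤ) % 2 = 1 ∧ (p : ℤ) % 3 ≠ 0 := by
  have h2 : ¬ 2 ∣ p := fun hd => by
    have := (Nat.prime_dvd_prime_iff_eq Nat.prime_two hp).1 hd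
    omega
  have h3 : ¬ 3 ∣ p := fun hd => by
    have := (Nat.prime_dvd_prime_iff_eq Nat.prime_three hp).1 hd
    omega
  omega

/-- The squares modulo `24`. -/
theorem sq_emod_twentyFour (k : ℤ) :
    (k ^ 2 % 24 = 0 ∨ k ^ 2 % 24 = 1 ∨ k ^ 2 % 24 = 4 ∨ k ^ 2 % 24 = 9 ∨
      k ^ 2 % 24 = 12 ∨ k ^ 2 % 24 = 16) := by
  have h0 : 0 ≤ k % 24 := by omega
  have h1 : k % 24 < 24 := by omega
  rw [sq, Int.mul_emod]
  generalize k % 24 = r at h0 h1 ⊢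
  interval_cases r <;> simp

theorem odd_right_of_gcd_eq_one {k y : ℤ} (hg : Int.gcd (2 * k) y = 1) : Odd y := by
  rw [← Int.not_even_iff_odd]
  intro hy
  have := Int.dvd_coe_gcd (dvd_mul_right 2 k) hy.two_dvd
  rw [hg] at this
  norm_num at this

theorem emod_of_hasPrimSol_one_mul {p : ℤ} (h2 : p % 2 = 1) (h3 : p % 3 ≠ 0)
    (h : HasPrimSol (1 * p)) : p % 24 = 1 := by
  obtain ⟨x, y, -, h⟩ := h
  have := sq_emod_twentyFour x
  omega

theorem emod_of_hasPrimSol_four_mul {p : ℤ} (h2 : p % 2 = 1) (h3 : p % 3 ≠ 0)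
    (h : HasPrimSol (4 * p)) : p % 24 = 7 := by
  obtain ⟨x, y, hg, h⟩ := h
  have hx : (2 : ℤ) ∣ x := Int.prime_two.dvd_of_dvd_pow (n := 2) (by omega)
  obtain ⟨k, rfl⟩ := hx
  obtain ⟨m, rfl⟩ := odd_right_of_gcd_eq_one hg
  have hk : p = k ^ 2 + 54 + 216 * (m ^ 2 + m) := by linarith
  have := sq_emod_twentyFour k
  omega

theorem emod_of_hasPrimSol_eight_mul {p : ℤ} (h3 : p % 3 ≠ 0)
    (h : HasPrimSol (8 * p)) : p % 24 = 5 ∨ p % 24 = 11 := by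
  obtain ⟨x, y, hg, h⟩ := h
  have hx : (2 : ℤ) ∣ x := Int.prime_two.dvd_of_dvd_pow (n := 2) (by omega)
  obtain ⟨k, rfl⟩ := hx
  obtain ⟨m, rfl⟩ := odd_right_of_gcd_eq_one hg
  have hk : k ^ 2 = 2 * (p - 27 - 108 * (m ^ 2 + m)) := by linarith
  obtain ⟨l, rfl⟩ : (2 : ℤ) ∣ k := Int.prime_two.dvd_of_dvd_pow ⟨_, hk⟩
  obtain ⟨n, hn⟩ := Int.even_mul_succ_self m
  have hl : p = 2 * l ^ 2 + 27 + 216 * n := by linarith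
  have := sq_emod_twentyFour l
  omega

theorem stmt7 (p : ℕ) (hp : p.Prime)
    (hP : ∃ j ∈ ({1, 4, 8} : Set ℤ), HasPrimSol (j * p)) :
    (∃! j : ℤ, j ∈ ({1, 4, 8} : Set ℤ) ∧ HasPrimSol (j * p)) ∧
    (∀ j ∈ ({1, 4, 8} : Set ℤ), HasPrimSol (j * p) →
      ((j = 1 → p % 24 = 1) ∧ (j = 4 → p % 24 = 7) ∧
       (j = 8 → (p % 24 = 5 ∨ p % 24 = 11)))) := by
  have hp2 := hp.two_le
  obtain ⟨j, hj, hs⟩ := hP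
  obtain ⟨h2, h3⟩ : (p : ℤ) % 2 = 1 ∧ (p : ℤ) % 3 ≠ 0 := by
    refine prime_coprime_six_of_le hp ?_
    rcases hj with rfl | rfl | rfl <;>
      have := le_of_hasPrimSol (by omega) hs <;> omega
  have key : ∀ i ∈ ({1, 4, 8} : Set ℤ), HasPrimSol (i * p) →
      ((i = 1 → p % 24 = 1) ∧ (i = 4 → p % 24 = 7) ∧
       (i = 8 → (p % 24 = 5 ∨ p % 24 = 11))) := by
    rintro i - hi
    refine ⟨?_, ?_, ?_⟩ <;> rintro rfl
    · have := emod_of_hasPrimSol_one_mul h2 h3 hi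
      omega
    · have := emod_of_hasPrimSol_four_mul h2 h3 hi
      omega
    · have := emod_of_hasPrimSol_eight_mul h3 hi
      omega
  refine ⟨⟨j, ⟨hj, hs⟩, ?_⟩, key⟩
  rintro i ⟨hi, his⟩
  have hkj := key j hj hs
  have hki := key i hi his
  simp only [Set.mem_insert_iff, Set.mem_singleton_iff] at hi hj
  omega
end

section
/- Let p be a prime in 𝒫, let j ∈ {1,4,8} be such that x² + 216y² = jp has a primitive solution, and let m be a positive integer coprime to p with pm ≡ 1 (mod 24). Then the number of pairs (x,y) ∈ ℤ² with x² + 216y² = pm and gcd(x,y) = 1 equals twice the number of pairs (a,b) ∈ ℤ² with a² + 216b² = jm and gcd(a,b) = 1. -/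
lemma odd_of_isCoprime_of_even {u v : ℤ} (h : IsCoprime u v) (hu : Even u) : Odd v := by
  rw [← Int.not_even_iff_odd]
  intro hv
  have := h.isUnit_of_dvd' hu.two_dvd hv.two_dvd
  rw [Int.isUnit_iff] at this
  omega

lemma exists_odd_of_sq_add_eq_four_mul {u v n : ℤ} (h : IsCoprime u v) (hn : Odd n)
    (e : u ^ 2 + 216 * v ^ 2 = 4 * n) : Odd v ∧ ∃ w, Odd w ∧ u = 2 * w := by
  have hu : Even u := by
    have : Even (u ^ 2) := ⟨2 * n - 108 * v ^ 2, by linarith⟩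
    exact (Int.even_pow.1 this).1
  refine ⟨odd_of_isCoprime_of_even h hu, ?_⟩
  obtain ⟨w, rfl⟩ := hu.two_dvd
  refine ⟨w, ?_, rfl⟩
  obtain ⟨k, rfl⟩ := hn
  have : Odd (w ^ 2) := ⟨k - 27 * v ^ 2, by linarith⟩
  exact (Int.odd_pow.1 this).resolve_right (by norm_num)

lemma exists_of_sq_add_eq_eight_mul {u v n : ℤ} (h : IsCoprime u v)
    (e : u ^ 2 + 216 * v ^ 2 = 8 * n) : Odd v ∧ ∃ w, u = 4 * w ∧ 2 * w ^ 2 + 27 * v ^ 2 = n := by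
  have hu : Even u := by
    have : Even (u ^ 2) := ⟨4 * n - 108 * v ^ 2, by linarith⟩
    exact (Int.even_pow.1 this).1
  refine ⟨odd_of_isCoprime_of_even h hu, ?_⟩
  obtain ⟨w, rfl⟩ := hu.two_dvd
  have hw : Even w := by
    have : Even (w ^ 2) := ⟨n - 27 * v ^ 2, by linarith⟩
    exact (Int.even_pow.1 this).1
  obtain ⟨k, rfl⟩ := hw.two_dvd
  exact ⟨k, by ring, by linarith⟩

lemma sq_emod_eight_of_odd {v : ℤ} (h : Odd v) : v ^ 2 % 8 = 1 := by
  obtain ⟨k, hk⟩ := Int.eight_dvd_sq_sub_one_of_odd h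
  omega

/-- If `u² + 216v² = jn` and `a² + 216b² = jm` are primitive, then `j` divides
`(a + b√-216)(u - v√-216)`. -/
lemma exists_eq_mul_conj {j u v a b n m : ℤ} (hj : j ∈ ({1, 4, 8} : Set ℤ))
    (hnm : n * m % 8 = 1) (huv : IsCoprime u v) (hab : IsCoprime a b)
    (e : u ^ 2 + 216 * v ^ 2 = j * n) (e' : a ^ 2 + 216 * b ^ 2 = j * m) :
    ∃ X Y, a * u + 216 * (b * v) = j * X ∧ b * u - a * v = j * Y := by
  have hodd : Odd (n * m) := Int.odd_iff.2 (by omega)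
  obtain ⟨hn, hm⟩ := Int.odd_mul.1 hodd
  rcases hj with rfl | rfl | rfl
  · exact ⟨_, _, (one_mul _).symm, (one_mul _).symm⟩
  · obtain ⟨hv, w, hw, rfl⟩ := exists_odd_of_sq_add_eq_four_mul huv hn e
    obtain ⟨hb, c, hc, rfl⟩ := exists_odd_of_sq_add_eq_four_mul hab hm e'
    obtain ⟨k, hk⟩ := (hb.mul hw).sub_odd (hc.mul hv)
    exact ⟨c * w + 54 * (b * v), k, by ring, by linear_combination 2 * hk⟩
  · obtain ⟨hv, w, rfl, hw⟩ := exists_of_sq_add_eq_eight_mul huv e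
    obtain ⟨hb, c, rfl, hc⟩ := exists_of_sq_add_eq_eight_mul hab e'
    have hpar : Even w ↔ Even c := by
      have h1 := sq_emod_eight_of_odd hv
      have h2 := sq_emod_eight_of_odd hb
      rcases Int.even_or_odd w with hw' | hw' <;> rcases Int.even_or_odd c with hc' | hc'
      · tauto
      · exfalso
        obtain ⟨k, rfl⟩ := hw'.two_dvd
        have h3 := sq_emod_eight_of_odd hc'
        have h4 : n % 8 = 3 := by rw [mul_pow] at hw; omega
        have h5 : m % 8 = 5 := by omega
        rw [Int.mul_emod] at hnm
        simp [h4, h5] at hnm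
      · exfalso
        obtain ⟨k, rfl⟩ := hc'.two_dvd
        have h3 := sq_emod_eight_of_odd hw'
        have h4 : m % 8 = 3 := by rw [mul_pow] at hc; omega
        have h5 : n % 8 = 5 := by omega
        rw [Int.mul_emod] at hnm
        simp [h4, h5] at hnm
      · rw [← Int.not_odd_iff_even, ← Int.not_odd_iff_even]
        tauto
    have : Even (b * w - c * v) := by
      rw [← Int.not_even_iff_odd] at hv hb
      simp only [Int.even_sub, Int.even_mul]
      tauto
    obtain ⟨k, hk⟩ := this
    exact ⟨2 * (c * w) + 27 * (b * v), k, by ring, by linear_combination 4 * hk⟩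

/-- A prime factor of `j` is no common divisor of `a` and `b` if `a² + 216b² = jm` and
`nm ≡ 1 mod 8`, where `jn` has a primitive representation. -/
lemma not_dvd_of_dvd {j u v a b n m q : ℤ} (hj : j ∈ ({1, 4, 8} : Set ℤ)) (hq : Prime q)
    (hqj : q ∣ j) (hnm : n * m % 8 = 1) (huv : IsCoprime u v)
    (e : u ^ 2 + 216 * v ^ 2 = j * n) (e' : a ^ 2 + 216 * b ^ 2 = j * m) (ha : q ∣ a) :
    ¬ q ∣ b := by
  intro hb
  have hodd : Odd (n * m) := Int.odd_iff.2 (by omega)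
  obtain ⟨hn, hm⟩ := Int.odd_mul.1 hodd
  have h2 : q ∣ 2 := by
    rcases hj with rfl | rfl | rfl
    · exact absurd (isUnit_of_dvd_one hqj) hq.not_isUnit
    · exact hq.dvd_of_dvd_pow (n := 2) (by simpa using hqj)
    · exact hq.dvd_of_dvd_pow (n := 3) (by simpa using hqj)
  have h2q : (2 : ℤ) ∣ q :=
    ((hq.associated_of_dvd Int.prime_two) h2).symm.dvd
  obtain ⟨c, rfl⟩ := h2q.trans ha
  obtain ⟨d, rfl⟩ := h2q.trans hb
  rcases hj with rfl | rfl | rfl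
  · exact hq.not_isUnit (isUnit_of_dvd_one hqj)
  · obtain ⟨hv, w, hw, rfl⟩ := exists_odd_of_sq_add_eq_four_mul huv hn e
    have hc : Odd c := by
      obtain ⟨k, rfl⟩ := hm
      have : Odd (c ^ 2) := ⟨k - 108 * d ^ 2, by linarith⟩
      exact (Int.odd_pow.1 this).resolve_right (by norm_num)
    have h1 := sq_emod_eight_of_odd hv
    have h2 := sq_emod_eight_of_odd hw
    have h3 := sq_emod_eight_of_odd hc
    have h4 : n % 8 = 7 := by rw [mul_pow] at e; omega
    have h5 : m % 8 = 1 := by rw [mul_pow, mul_pow] at e'; omega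
    rw [Int.mul_emod] at hnm
    simp [h4, h5] at hnm
  · have hc : Even c := by
      have : Even (c ^ 2) := ⟨m - 108 * d ^ 2, by linarith⟩
      exact (Int.even_pow.1 this).1
    obtain ⟨k, rfl⟩ := hc.two_dvd
    obtain ⟨l, rfl⟩ := hm
    rw [mul_pow, mul_pow, mul_pow] at e'
    omega

/-- Multiplication by `(u + v√-216) / p` maps the primitive solutions of `X² + 216Y² = pm` for
which the quotient is integral bijectively to those of `a² + 216b² = jm`. -/
lemma ncard_dvd_eq {j u v p m : ℤ} (hp : Prime p) (hj : j ∈ ({1, 4, 8} : Set ℤ))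
    (huv : IsCoprime u v) (e : u ^ 2 + 216 * v ^ 2 = j * p)
    (hm : 0 < m) (hcop : ¬ p ∣ m) (hmod : p * m % 8 = 1) :
    Set.ncard {xy : ℤ × ℤ | (xy.1 ^ 2 + 216 * xy.2 ^ 2 = p * m ∧ IsCoprime xy.1 xy.2) ∧
      p ∣ v * xy.1 + u * xy.2} =
    Set.ncard {ab : ℤ × ℤ | ab.1 ^ 2 + 216 * ab.2 ^ 2 = j * m ∧ IsCoprime ab.1 ab.2} := by
  have hp0 : p ≠ 0 := hp.ne_zero
  have hj0 : j ≠ 0 := by rcases hj with rfl | rfl | rfl <;> norm_num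
  have hjpos : 0 < j := by rcases hj with rfl | rfl | rfl <;> norm_num
  refine Set.ncard_congr
    (fun xy _ => ((u * xy.1 - 216 * (v * xy.2)) / p, (v * xy.1 + u * xy.2) / p)) ?_ ?_ ?_
  · rintro ⟨X, Y⟩ ⟨⟨hXY, hc⟩, b, hb⟩
    dsimp only at hXY hc hb ⊢
    have hnorm : (u * X - 216 * (v * Y)) ^ 2 = p * (p * (j * m - 216 * b ^ 2)) := by
      linear_combination (u ^ 2 + 216 * v ^ 2) * hXY + p * m * e
        - 216 * (v * X + u * Y + p * b) * hb
    obtain ⟨a, ha⟩ : p ∣ u * X - 216 * (v * Y) := hp.dvd_of_dvd_pow ⟨_, hnorm⟩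
    rw [ha, hb, Int.mul_ediv_cancel_left _ hp0, Int.mul_ediv_cancel_left _ hp0]
    have e' : a ^ 2 + 216 * b ^ 2 = j * m := by
      rw [ha] at hnorm
      apply mul_left_cancel₀ (pow_ne_zero 2 hp0)
      linear_combination hnorm
    have hX : a * u + 216 * (b * v) = j * X := by
      apply mul_left_cancel₀ hp0
      linear_combination X * e - u * ha - 216 * v * hb
    have hY : b * u - a * v = j * Y := by
      apply mul_left_cancel₀ hp0
      linear_combination Y * e + v * ha - u * hb
    refine ⟨e', isCoprime_of_prime_dvd ?_ ?_⟩
    · rintro ⟨rfl, rfl⟩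
      have : 0 < j * m := mul_pos hjpos hm
      simp at e'
      omega
    · intro q hq hqa hqb
      by_cases hqj : q ∣ j
      · exact not_dvd_of_dvd hj hq hqj hmod huv e e' hqa hqb
      · have h1 : q ∣ j * X := hX ▸ (dvd_add (hqa.mul_right _) ((hqb.mul_right _).mul_left _))
        have h2 : q ∣ j * Y := hY ▸ (dvd_sub (hqb.mul_right _) (hqa.mul_right _))
        exact hq.not_isUnit (hc.isUnit_of_dvd' ((hq.dvd_or_dvd h1).resolve_left hqj)
          ((hq.dvd_or_dvd h2).resolve_left hqj))
  · rintro ⟨X, Y⟩ ⟨X', Y'⟩ ⟨⟨hXY, -⟩, b, hb⟩ ⟨⟨hXY', -⟩, b', hb'⟩ h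
    dsimp only at hXY hXY' hb hb' h
    have hnorm : (u * X - 216 * (v * Y)) ^ 2 = p * (p * (j * m - 216 * b ^ 2)) := by
      linear_combination (u ^ 2 + 216 * v ^ 2) * hXY + p * m * e
        - 216 * (v * X + u * Y + p * b) * hb
    have hnorm' : (u * X' - 216 * (v * Y')) ^ 2 = p * (p * (j * m - 216 * b' ^ 2)) := by
      linear_combination (u ^ 2 + 216 * v ^ 2) * hXY' + p * m * e
        - 216 * (v * X' + u * Y' + p * b') * hb'
    obtain ⟨a, ha⟩ : p ∣ u * X - 216 * (v * Y) := hp.dvd_of_dvd_pow ⟨_, hnorm⟩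
    obtain ⟨a', ha'⟩ : p ∣ u * X' - 216 * (v * Y') := hp.dvd_of_dvd_pow ⟨_, hnorm'⟩
    rw [ha, hb, ha', hb'] at h
    simp only [Int.mul_ediv_cancel_left _ hp0, Prod.mk.injEq] at h
    obtain ⟨rfl, rfl⟩ := h
    have hjp : j * p ≠ 0 := mul_ne_zero hj0 hp0
    ext
    · apply mul_left_cancel₀ hjp
      linear_combination (X' - X) * e + u * (ha - ha') + 216 * v * (hb - hb')
    · apply mul_left_cancel₀ hjp
      linear_combination (Y' - Y) * e - v * (ha - ha') + u * (hb - hb')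
  · rintro ⟨a, b⟩ ⟨e', hab⟩
    dsimp only at e' hab
    obtain ⟨X, Y, hX, hY⟩ := exists_eq_mul_conj hj hmod huv hab e e'
    have ha : u * X - 216 * (v * Y) = p * a := by
      apply mul_left_cancel₀ hj0
      linear_combination a * e - u * hX + 216 * v * hY
    have hb : v * X + u * Y = p * b := by
      apply mul_left_cancel₀ hj0
      linear_combination b * e - v * hX - u * hY
    have hXY : X ^ 2 + 216 * Y ^ 2 = p * m := by
      apply mul_left_cancel₀ (pow_ne_zero 2 hj0)
      linear_combination (a ^ 2 + 216 * b ^ 2) * e + j * p * e'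
        - (a * u + 216 * (b * v) + j * X) * hX - 216 * (b * u - a * v + j * Y) * hY
    refine ⟨(X, Y), ⟨⟨hXY, isCoprime_of_prime_dvd ?_ ?_⟩, b, hb⟩, ?_⟩
    · rintro ⟨rfl, rfl⟩
      exact mul_ne_zero hp0 hm.ne' (by simpa using hXY.symm)
    · intro q hq hqX hqY
      have hqp : ¬ q ∣ p := by
        intro h
        have hpq : p ∣ q := (hq.associated_of_dvd hp h).symm.dvd
        obtain ⟨x, rfl⟩ := hpq.trans hqX
        obtain ⟨y, rfl⟩ := hpq.trans hqY
        apply hcop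
        refine ⟨x ^ 2 + 216 * y ^ 2, mul_left_cancel₀ hp0 ?_⟩
        linear_combination -hXY
      have h1 : q ∣ p * a :=
        ha ▸ dvd_sub (hqX.mul_left _) ((hqY.mul_left _).mul_left _)
      have h2 : q ∣ p * b := hb ▸ dvd_add (hqX.mul_left _) (hqY.mul_left _)
      exact hq.not_isUnit (hab.isUnit_of_dvd' ((hq.dvd_or_dvd h1).resolve_left hqp)
        ((hq.dvd_or_dvd h2).resolve_left hqp))
    · simp only [ha, hb, Int.mul_ediv_cancel_left _ hp0]

lemma finite_sq_add_eq (n : ℤ) :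
    {xy : ℤ × ℤ | xy.1 ^ 2 + 216 * xy.2 ^ 2 = n}.Finite := by
  refine ((Set.finite_Icc (-n) n).prod (Set.finite_Icc (-n) n)).subset ?_
  rintro ⟨x, y⟩ h
  simp only [Set.mem_ofPred_eq] at h
  have hx := Int.le_self_sq x
  have hx' := Int.le_self_sq (-x)
  have hy := Int.le_self_sq y
  have hy' := Int.le_self_sq (-y)
  rw [neg_sq] at hx' hy'
  have := sq_nonneg x
  have := sq_nonneg y
  refine ⟨⟨?_, ?_⟩, ⟨?_, ?_⟩⟩ <;> dsimp only <;> linarith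

theorem stmt8 (p : ℕ) (hp : p.Prime) (j : ℤ) (hj : j ∈ ({1, 4, 8} : Set ℤ))
    (hjp : ∃ x y : ℤ, Int.gcd x y = 1 ∧ x ^ 2 + 216 * y ^ 2 = j * p)
    (m : ℕ) (hm : 0 < m) (hcop : Nat.Coprime p m) (hmod : (p * m) % 24 = 1) :
    Set.ncard {xy : ℤ × ℤ |
        xy.1 ^ 2 + 216 * xy.2 ^ 2 = (p : ℤ) * m ∧ Int.gcd xy.1 xy.2 = 1} =
    2 * Set.ncard {ab : ℤ × ℤ |
        ab.1 ^ 2 + 216 * ab.2 ^ 2 = j * m ∧ Int.gcd ab.1 ab.2 = 1} := by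
  obtain ⟨u, v, huv, e⟩ := hjp
  simp only [← Int.isCoprime_iff_gcd_eq_one] at huv ⊢
  have hpZ : Prime (p : ℤ) := Nat.prime_iff_prime_int.1 hp
  have hmod8 : (p : ℤ) * m % 8 = 1 := by
    have : p * m % 8 = 1 := by omega
    exact_mod_cast this
  have hpm : ¬ (p : ℤ) ∣ m := by
    rw [Int.natCast_dvd_natCast]
    exact (hp.coprime_iff_not_dvd).1 hcop
  have hp2 : ¬ (p : ℤ) ∣ 2 := by
    intro h
    have h' : p ∣ 2 := by exact_mod_cast h
    obtain rfl := (Nat.prime_dvd_prime_iff_eq hp Nat.prime_two).1 h'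
    omega
  have hp3 : ¬ (p : ℤ) ∣ 3 := by
    intro h
    have h' : p ∣ 3 := by exact_mod_cast h
    obtain rfl := (Nat.prime_dvd_prime_iff_eq hp Nat.prime_three).1 h'
    omega
  have hp216 : ¬ (p : ℤ) ∣ 216 := by
    intro h
    rw [show (216 : ℤ) = 2 ^ 3 * 3 ^ 3 by norm_num] at h
    rcases hpZ.dvd_or_dvd h with h | h
    · exact hp2 (hpZ.dvd_of_dvd_pow h)
    · exact hp3 (hpZ.dvd_of_dvd_pow h)
  have hpj : ¬ (p : ℤ) ∣ j := by
    intro h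
    apply hp2
    rcases hj with rfl | rfl | rfl
    · exact h.trans (one_dvd _)
    · exact hpZ.dvd_of_dvd_pow (n := 2) (by simpa using h)
    · exact hpZ.dvd_of_dvd_pow (n := 3) (by simpa using h)
  have hpv : ¬ (p : ℤ) ∣ v := by
    rintro ⟨y, rfl⟩
    have h : (p : ℤ) ∣ u ^ 2 := ⟨j - 216 * p * y ^ 2, by linear_combination e⟩
    obtain ⟨x, rfl⟩ := hpZ.dvd_of_dvd_pow h
    apply hpj
    refine ⟨x ^ 2 + 216 * y ^ 2, mul_left_cancel₀ hpZ.ne_zero ?_⟩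
    linear_combination -e
  have hpu : ¬ (p : ℤ) ∣ u := by
    rintro ⟨x, rfl⟩
    have h : (p : ℤ) ∣ 216 * v ^ 2 := ⟨j - p * x ^ 2, by linear_combination e⟩
    rcases hpZ.dvd_or_dvd h with h | h
    · exact hp216 h
    · exact hpv (hpZ.dvd_of_dvd_pow h)
  have hmZ : (0 : ℤ) < m := by exact_mod_cast hm
  have c1 := ncard_dvd_eq hpZ hj huv e hmZ hpm hmod8
  have c2 := ncard_dvd_eq hpZ hj huv.neg_right (by rw [neg_sq]; exact e) hmZ hpm hmod8
  rw [two_mul]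
  nth_rw 1 [← c1]
  rw [← c2, ← Set.ncard_union_eq ?_ ((finite_sq_add_eq _).subset fun _ h => h.1.1)
    ((finite_sq_add_eq _).subset fun _ h => h.1.1)]
  · congr 1
    ext ⟨X, Y⟩
    simp only [Set.mem_union, Set.mem_ofPred_eq, ← and_or_left]
    refine (and_iff_left_of_imp ?_).symm
    rintro ⟨hXY, -⟩
    have h : (p : ℤ) ∣ (v * X + u * Y) * (-v * X + u * Y) :=
      ⟨j * Y ^ 2 - v ^ 2 * m, by linear_combination Y ^ 2 * e - v ^ 2 * hXY⟩
    exact hpZ.dvd_or_dvd h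
  · rw [Set.disjoint_left]
    rintro ⟨X, Y⟩ ⟨⟨-, hc⟩, h1⟩ ⟨-, h2⟩
    dsimp only at hc h1 h2
    have hX : (p : ℤ) ∣ 2 * (v * X) := by
      have := dvd_sub h1 h2
      rwa [show v * X + u * Y - (-v * X + u * Y) = 2 * (v * X) by ring] at this
    have hY : (p : ℤ) ∣ 2 * (u * Y) := by
      have := dvd_add h1 h2
      rwa [show v * X + u * Y + (-v * X + u * Y) = 2 * (u * Y) by ring] at this
    exact hpZ.not_isUnit (hc.isUnit_of_dvd'
      ((hpZ.dvd_or_dvd ((hpZ.dvd_or_dvd hX).resolve_left hp2)).resolve_left hpv)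
      ((hpZ.dvd_or_dvd ((hpZ.dvd_or_dvd hY).resolve_left hp2)).resolve_left hpu))
end

section
/- Let p be a prime in 𝒫 and let m be a positive integer coprime to p with pm ≡ 1 (mod 24). Let N₂(pm) denote the number of pairs (x,y) ∈ ℤ² with x² + 216y² = pm and gcd(x,y) = 1. If m > 1 then N₂(pm) ≡ 0 (mod 8), and if m = 1 then N₂(p) = 4. -/
/-- If an involution of a finite set exchanges a predicate with its negation, then the predicate
holds on exactly half of the set. -/
theorem ncard_eq_two_mul_of_involution {α : Type*} {S : Set α} (hS : S.Finite) (P : α → Prop)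
    (f : α → α) (hf : ∀ x ∈ S, f x ∈ S) (hff : ∀ x ∈ S, f (f x) = x)
    (hP : ∀ x ∈ S, P (f x) ↔ ¬ P x) : S.ncard = 2 * {x ∈ S | P x}.ncard := by
  have himg : {x ∈ S | ¬ P x} = f '' {x ∈ S | P x} := by
    ext x
    constructor
    · rintro ⟨hx, hn⟩
      exact ⟨f x, ⟨hf x hx, (hP x hx).2 hn⟩, hff x hx⟩
    · rintro ⟨y, ⟨hy, hPy⟩, rfl⟩
      exact ⟨hf y hy, fun h => (hP y hy).1 h hPy⟩
  have hinj : Set.InjOn f {x ∈ S | P x} := by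
    intro x hx y hy hxy
    rw [← hff x hx.1, ← hff y hy.1, hxy]
  have hun : S = {x ∈ S | P x} ∪ {x ∈ S | ¬ P x} := by
    ext x
    simp only [Set.mem_union, Set.mem_ofPred_eq]
    tauto
  have hdis : Disjoint {x ∈ S | P x} {x ∈ S | ¬ P x} := by
    rw [Set.disjoint_left]
    exact fun x hx hx' => hx'.2 hx.2
  have hcard := Set.ncard_union_eq hdis (hS.subset (Set.sep_subset _ _))
    (hS.subset (Set.sep_subset _ _))
  rw [← hun, himg, hinj.ncard_image] at hcard
  omega

theorem finite_primitive_solutions (w : ℤ) :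
    {xy : ℤ × ℤ | xy.1 ^ 2 + 216 * xy.2 ^ 2 = w ∧ Int.gcd xy.1 xy.2 = 1}.Finite := by
  refine ((Set.finite_Icc (-w) w).prod (Set.finite_Icc (-w) w)).subset ?_
  rintro ⟨x, y⟩ ⟨h, -⟩
  simp only at h
  simp only [Set.mem_prod, Set.mem_Icc]
  have hx := Int.le_self_sq x
  have hx' := Int.le_self_sq (-x)
  have hy := Int.le_self_sq y
  have hy' := Int.le_self_sq (-y)
  refine ⟨⟨?_, ?_⟩, ?_, ?_⟩ <;> nlinarith [sq_nonneg x, sq_nonneg y]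

/-- The square of a primitive element of norm `j * p` in `ℤ[√-216]` is divisible by `j`
when `j ∈ {1, 4, 8}`. -/
theorem exists_sq_div {j p a b : ℤ} (hj : j = 1 ∨ j = 4 ∨ j = 8)
    (h : a ^ 2 + 216 * b ^ 2 = j * p) :
    ∃ A B : ℤ, j * A = a ^ 2 - 216 * b ^ 2 ∧ j * B = 2 * a * b := by
  have even_of_sq : ∀ z : ℤ, 2 ∣ z ^ 2 → 2 ∣ z := fun z => Int.prime_two.dvd_of_dvd_pow
  rcases hj with rfl | rfl | rfl
  · exact ⟨_, _, one_mul _, one_mul _⟩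
  · obtain ⟨c, rfl⟩ := even_of_sq a ⟨2 * p - 108 * b ^ 2, by linarith⟩
    exact ⟨c ^ 2 - 54 * b ^ 2, c * b, by ring, by ring⟩
  · obtain ⟨c, rfl⟩ := even_of_sq a ⟨4 * p - 108 * b ^ 2, by linarith⟩
    obtain ⟨d, rfl⟩ := even_of_sq c ⟨p - 27 * b ^ 2, by linarith⟩
    exact ⟨2 * d ^ 2 - 27 * b ^ 2, d * b, by ring, by ring⟩

/-- Two proportional primitive vectors agree up to sign. -/
theorem sq_eq_of_mul_eq_mul {a b x y : ℤ} (hab : IsCoprime a b) (hxy : IsCoprime x y)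
    (h : a * y = b * x) : x ^ 2 = a ^ 2 ∧ y ^ 2 = b ^ 2 := by
  have hax : a ∣ x := hab.dvd_of_dvd_mul_left ⟨y, h.symm⟩
  have hxa : x ∣ a := hxy.dvd_of_dvd_mul_right ⟨b, by linarith⟩
  have hby : b ∣ y := hab.symm.dvd_of_dvd_mul_left ⟨x, h⟩
  have hyb : y ∣ b := hxy.symm.dvd_of_dvd_mul_right ⟨a, by linarith⟩
  rw [← Int.natAbs_eq_iff_sq_eq, ← Int.natAbs_eq_iff_sq_eq]
  exact ⟨Int.natAbs_eq_of_dvd_dvd hxa hax, Int.natAbs_eq_of_dvd_dvd hyb hby⟩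

theorem not_dvd_of_primitive {p x y w : ℤ} (hp : Prime p) (h6 : ¬ p ∣ 216) (hxy : IsCoprime x y)
    (h : x ^ 2 + 216 * y ^ 2 = w) (hw : p ∣ w) : ¬ p ∣ x ∧ ¬ p ∣ y := by
  have hx : ¬ p ∣ x := by
    intro hx
    have h1 : p ∣ 216 * y ^ 2 := by
      rw [show 216 * y ^ 2 = w - x ^ 2 by linarith]
      exact dvd_sub hw (dvd_pow hx two_ne_zero)
    have hy : p ∣ y := hp.dvd_of_dvd_pow ((hp.dvd_or_dvd h1).resolve_left h6)
    exact hp.not_isUnit (hxy.isUnit_of_dvd' hx hy)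
  refine ⟨hx, fun hy => hx (hp.dvd_of_dvd_pow (n := 2) ?_)⟩
  rw [show x ^ 2 = w - 216 * y ^ 2 by linarith]
  exact dvd_sub hw ((dvd_pow hy two_ne_zero).mul_left _)

/-- Multiplying by an element of norm `p ^ 2` and dividing by `p` preserves primitive
solutions. -/
theorem twist_primitive {p m A B X Y X' Y' : ℤ} (hp : Prime p) (hpm : ¬ p ∣ m)
    (hAB : A ^ 2 + 216 * B ^ 2 = p ^ 2) (hXY : IsCoprime X Y)
    (h : X ^ 2 + 216 * Y ^ 2 = p * m)
    (hX' : p * X' = A * X - 216 * B * Y) (hY' : p * Y' = -(A * Y + B * X)) :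
    X' ^ 2 + 216 * Y' ^ 2 = p * m ∧ IsCoprime X' Y' ∧ A * X' - 216 * B * Y' = p * X ∧
      A * Y' + B * X' = -(p * Y) := by
  have hp0 := hp.ne_zero
  have hn : X' ^ 2 + 216 * Y' ^ 2 = p * m := by
    apply mul_left_cancel₀ (pow_ne_zero 2 hp0)
    calc p ^ 2 * (X' ^ 2 + 216 * Y' ^ 2) = (p * X') ^ 2 + 216 * (p * Y') ^ 2 := by ring
      _ = (A ^ 2 + 216 * B ^ 2) * (X ^ 2 + 216 * Y ^ 2) := by rw [hX', hY']; ring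
      _ = _ := by rw [hAB, h]
  have h1 : A * X' - 216 * B * Y' = p * X := by
    apply mul_left_cancel₀ hp0
    linear_combination A * hX' - 216 * B * hY' + X * hAB
  have h2 : A * Y' + B * X' = -(p * Y) := by
    apply mul_left_cancel₀ hp0
    linear_combination A * hY' + B * hX' - Y * hAB
  refine ⟨hn, ?_, h1, h2⟩
  refine isCoprime_of_prime_dvd ?_ fun q hq hqX hqY => ?_
  · rintro ⟨rfl, rfl⟩
    have hm : p * m = 0 := by simpa using hn.symm
    exact hpm ((mul_eq_zero.1 hm).resolve_left hp0 ▸ dvd_zero p)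
  have hqp : ¬ q ∣ p := by
    intro hqp
    have hpq := hq.irreducible.dvd_symm hp.irreducible hqp
    obtain ⟨c, rfl⟩ := hpq.trans hqX
    obtain ⟨d, rfl⟩ := hpq.trans hqY
    refine hpm ⟨c ^ 2 + 216 * d ^ 2, mul_left_cancel₀ hp0 ?_⟩
    linear_combination -hn
  have hX : q ∣ p * X := h1 ▸ dvd_sub (hqX.mul_left _) (hqY.mul_left _)
  have hY : q ∣ p * Y := by
    rw [← dvd_neg, ← h2]
    exact dvd_add (hqY.mul_left _) (hqX.mul_left _)
  exact hq.not_isUnit (hXY.isUnit_of_dvd' ((hq.dvd_or_dvd hX).resolve_left hqp)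
    ((hq.dvd_or_dvd hY).resolve_left hqp))

theorem eight_dvd_ncard {p m j a b k : ℤ} (hp : Prime p) (hpm : ¬ p ∣ m)
    (hj : j = 1 ∨ j = 4 ∨ j = 8) (hab : IsCoprime a b) (h : a ^ 2 + 216 * b ^ 2 = j * p)
    (hmod : p * m = 24 * k + 1) (hm : m ≠ 1) :
    8 ∣ Set.ncard {xy : ℤ × ℤ |
      xy.1 ^ 2 + 216 * xy.2 ^ 2 = p * m ∧ Int.gcd xy.1 xy.2 = 1} := by
  have hp0 := hp.ne_zero
  have hj0 : j ≠ 0 := by omega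
  have h6 : ¬ p ∣ 216 := by
    intro h6
    have h1 : IsCoprime p 6 := ⟨m, -(4 * k), by linear_combination hmod⟩
    exact hp.not_isUnit ((h1.pow_right (n := 3)).isUnit_of_dvd' dvd_rfl (by norm_num [h6]))
  have h2 : ¬ p ∣ 2 := fun h2 => h6 (h2.trans (by norm_num))
  obtain ⟨A, B, hA, hB⟩ := exists_sq_div hj h
  obtain ⟨hpa, hpb⟩ := not_dvd_of_primitive hp h6 hab h (dvd_mul_left p j)
  have hpA : ¬ p ∣ A := by
    intro hdvd
    have h3 : p ∣ 2 * a ^ 2 := by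
      rw [show 2 * a ^ 2 = j * A + j * p by linear_combination -hA + h]
      exact dvd_add (hdvd.mul_left _) (dvd_mul_left _ _)
    exact hpa (hp.dvd_of_dvd_pow ((hp.dvd_or_dvd h3).resolve_left h2))
  have hAB : A ^ 2 + 216 * B ^ 2 = p ^ 2 := by
    apply mul_left_cancel₀ (pow_ne_zero 2 hj0)
    calc j ^ 2 * (A ^ 2 + 216 * B ^ 2) = (j * A) ^ 2 + 216 * (j * B) ^ 2 := by ring
      _ = (a ^ 2 + 216 * b ^ 2) ^ 2 := by rw [hA, hB]; ring
      _ = _ := by rw [h]; ring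
  have hau : a * A + 216 * b * B = a * p := by
    apply mul_left_cancel₀ hj0
    linear_combination a * hA + 216 * b * hB + a * h
  have hav : b * A - a * B = -(b * p) := by
    apply mul_left_cancel₀ hj0
    linear_combination b * hA - a * hB - b * h
  set S := {xy : ℤ × ℤ | xy.1 ^ 2 + 216 * xy.2 ^ 2 = p * m ∧ Int.gcd xy.1 xy.2 = 1} with hS
  have hfin : S.Finite := finite_primitive_solutions _
  have hu : ∀ x ∈ S, a * x.1 - 216 * b * x.2 ≠ 0 := by
    rintro ⟨X, Y⟩ ⟨hn, hg⟩ h0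
    simp only at hn hg h0
    rw [← Int.isCoprime_iff_gcd_eq_one] at hg
    have hX6 : IsCoprime X 6 :=
      ⟨X, 36 * Y ^ 2 - 4 * k, by linear_combination hn + hmod⟩
    have hX216 : IsCoprime X 216 := by simpa using hX6.pow_right (n := 3)
    obtain ⟨h3, h4⟩ := sq_eq_of_mul_eq_mul (x := 216 * Y) (y := X) hab
      (hX216.mul_right hg).symm (by linear_combination h0)
    have h5 : 216 * m = j := by
      apply mul_left_cancel₀ hp0
      linear_combination -216 * hn + h + 216 * h4 + h3
    omega
  have hv : ∀ x ∈ S, a * x.2 + b * x.1 ≠ 0 := by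
    rintro ⟨X, Y⟩ ⟨hn, hg⟩ h0
    simp only at hn hg h0
    rw [← Int.isCoprime_iff_gcd_eq_one] at hg
    obtain ⟨h3, h4⟩ := sq_eq_of_mul_eq_mul (x := X) (y := -Y) hab
      hg.neg_right (by linear_combination -h0)
    have h5 : m = j := by
      apply mul_left_cancel₀ hp0
      linear_combination -hn + h + 216 * h4 + h3
    subst h5
    rcases hj with rfl | rfl | rfl <;> omega
  have hconj := ncard_eq_two_mul_of_involution hfin
    (fun x => p ∣ A * x.1 - 216 * B * x.2) (fun x => (x.1, -x.2))
    (by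
      rintro ⟨X, Y⟩ ⟨hn, hg⟩
      exact ⟨by simpa using hn, by simpa using hg⟩)
    (fun x _ => by simp)
    (by
      rintro ⟨X, Y⟩ ⟨hn, hg⟩
      simp only at hn hg
      rw [← Int.isCoprime_iff_gcd_eq_one] at hg
      obtain ⟨hpX, -⟩ := not_dvd_of_primitive hp h6 hg hn (dvd_mul_right p m)
      simp only
      constructor
      · intro h3 h4
        have h5 : p ∣ 2 * (A * X) := by
          rw [show 2 * (A * X) = A * X - 216 * B * -Y + (A * X - 216 * B * Y) by ring]
          exact dvd_add h3 h4
        rcases hp.dvd_or_dvd ((hp.dvd_or_dvd h5).resolve_left h2) with h | h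
        exacts [hpA h, hpX h]
      · intro h3
        refine (hp.dvd_or_dvd (b := A * X - 216 * B * Y) ?_).resolve_right h3
        refine ⟨A ^ 2 * m - 216 * Y ^ 2 * p, ?_⟩
        linear_combination A ^ 2 * hn - 216 * Y ^ 2 * hAB)
  set S₁ := {x ∈ S | p ∣ A * x.1 - 216 * B * x.2} with hS₁
  have hfin₁ : S₁.Finite := hfin.subset (Set.sep_subset _ _)
  have hneg := ncard_eq_two_mul_of_involution hfin₁
    (fun x => 0 < a * x.1 - 216 * b * x.2) (fun x => -x)
    (by
      rintro ⟨X, Y⟩ ⟨⟨hn, hg⟩, hd⟩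
      refine ⟨⟨by simpa using hn, by simpa using hg⟩, ?_⟩
      have h3 := hd.neg_right
      rwa [show -(A * X - 216 * B * Y) = A * -X - 216 * B * -Y by ring] at h3)
    (fun x _ => neg_neg x)
    (by
      intro x hx
      have h3 := hu x hx.1
      simp only [Prod.fst_neg, Prod.snd_neg, mul_neg]
      omega)
  set S₂ := {x ∈ S₁ | 0 < a * x.1 - 216 * b * x.2} with hS₂
  have hfin₂ : S₂.Finite := hfin₁.subset (Set.sep_subset _ _)
  have hdiv : ∀ x ∈ S₁, ∃ X' Y' : ℤ,
      p * X' = A * x.1 - 216 * B * x.2 ∧ p * Y' = -(A * x.2 + B * x.1) := by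
    rintro ⟨X, Y⟩ ⟨⟨hn, -⟩, c, hc⟩
    simp only at hn hc ⊢
    have h3 : p ∣ 216 * (A * Y + B * X) ^ 2 := by
      refine ⟨p * p * m - p * c ^ 2, ?_⟩
      have h4 : (A * X - 216 * B * Y) ^ 2 + 216 * (A * Y + B * X) ^ 2 = p ^ 2 * (p * m) := by
        rw [← hAB, ← hn]
        ring
      rw [hc] at h4
      linear_combination h4
    obtain ⟨d, hd⟩ := hp.dvd_of_dvd_pow ((hp.dvd_or_dvd h3).resolve_left h6)
    exact ⟨c, -d, hc.symm, by rw [hd]; ring⟩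
  have htwist := ncard_eq_two_mul_of_involution hfin₂ (fun x => 0 < a * x.2 + b * x.1)
    (fun x => ((A * x.1 - 216 * B * x.2) / p, -(A * x.2 + B * x.1) / p))
    (by
      rintro ⟨X, Y⟩ ⟨hx, hpos⟩
      obtain ⟨X', Y', hX', hY'⟩ := hdiv _ hx
      obtain ⟨⟨hn, hg⟩, -⟩ := hx
      simp only at hn hg hpos hX' hY' ⊢
      rw [← Int.isCoprime_iff_gcd_eq_one] at hg
      obtain ⟨h3, h4, h5, -⟩ := twist_primitive hp hpm hAB hg hn hX' hY'
      rw [← hX', ← hY', Int.mul_ediv_cancel_left _ hp0, Int.mul_ediv_cancel_left _ hp0]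
      refine ⟨⟨⟨h3, Int.isCoprime_iff_gcd_eq_one.1 h4⟩, ?_⟩, ?_⟩
      · exact ⟨X, h5⟩
      · have h6 : a * X' - 216 * b * Y' = a * X - 216 * b * Y := by
          apply mul_left_cancel₀ hp0
          linear_combination a * hX' - 216 * b * hY' + X * hau + 216 * Y * hav
        simpa only [h6] using hpos)
    (by
      rintro ⟨X, Y⟩ ⟨hx, -⟩
      obtain ⟨X', Y', hX', hY'⟩ := hdiv _ hx
      obtain ⟨⟨hn, hg⟩, -⟩ := hx
      simp only at hn hg hX' hY' ⊢
      rw [← Int.isCoprime_iff_gcd_eq_one] at hg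
      obtain ⟨-, -, h5, h6⟩ := twist_primitive hp hpm hAB hg hn hX' hY'
      rw [← hX', ← hY', Int.mul_ediv_cancel_left _ hp0, Int.mul_ediv_cancel_left _ hp0, h5, h6,
        neg_neg, Int.mul_ediv_cancel_left _ hp0, Int.mul_ediv_cancel_left _ hp0])
    (by
      rintro ⟨X, Y⟩ ⟨hx, -⟩
      have h3 := hv _ hx.1
      obtain ⟨X', Y', hX', hY'⟩ := hdiv _ hx
      simp only at h3 hX' hY' ⊢
      rw [← hX', ← hY', Int.mul_ediv_cancel_left _ hp0, Int.mul_ediv_cancel_left _ hp0]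
      have h4 : a * Y' + b * X' = -(a * Y + b * X) := by
        apply mul_left_cancel₀ hp0
        linear_combination a * hY' + b * hX' - Y * hau + X * hav
      rw [h4]
      omega)
  omega

theorem ncard_primitive_prime {p a b : ℤ} (hp : Prime p) (hab : IsCoprime a b)
    (ha : a ≠ 0) (hb : b ≠ 0) (h : a ^ 2 + 216 * b ^ 2 = p) :
    Set.ncard {xy : ℤ × ℤ | xy.1 ^ 2 + 216 * xy.2 ^ 2 = p ∧ Int.gcd xy.1 xy.2 = 1} = 4 := by
  have hp0 : 0 < p := by
    rw [← h]
    positivity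
  have key : ∀ x y : ℤ, x ^ 2 + 216 * y ^ 2 = p → IsCoprime x y → p ∣ a * y - b * x →
      x ^ 2 = a ^ 2 ∧ y ^ 2 = b ^ 2 := by
    rintro x y hn hg ⟨c, hc⟩
    refine sq_eq_of_mul_eq_mul hab hg ?_
    have h1 : (a * x + 216 * b * y) ^ 2 + 216 * (a * y - b * x) ^ 2 = p * p := by
      nth_rewrite 1 [← h]
      rw [← hn]
      ring
    have hc0 : c = 0 := by
      rw [hc] at h1
      by_contra hc0
      have h2 : 0 < c ^ 2 := by positivity
      nlinarith [sq_nonneg (a * x + 216 * b * y), mul_pos hp0 hp0]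
    rw [hc0, mul_zero] at hc
    linarith
  have hset : {xy : ℤ × ℤ | xy.1 ^ 2 + 216 * xy.2 ^ 2 = p ∧ Int.gcd xy.1 xy.2 = 1} =
      (({(a, b), (a, -b), (-a, b), (-a, -b)} : Finset (ℤ × ℤ)) : Set (ℤ × ℤ)) := by
    ext ⟨x, y⟩
    simp only [Set.mem_ofPred_eq, Finset.coe_insert, Finset.coe_singleton, Set.mem_insert_iff,
      Set.mem_singleton_iff, Prod.mk.injEq, ← Int.isCoprime_iff_gcd_eq_one]
    constructor
    · rintro ⟨hn, hg⟩
      have hd : p ∣ (a * y - b * x) * (a * y + b * x) :=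
        ⟨y ^ 2 - b ^ 2, by linear_combination y ^ 2 * h - b ^ 2 * hn⟩
      have hsq : x ^ 2 = a ^ 2 ∧ y ^ 2 = b ^ 2 := by
        rcases hp.dvd_or_dvd hd with hd | hd
        · exact key x y hn hg hd
        · simpa using key (-x) y (by simpa using hn) hg.neg_left (by simpa using hd)
      rcases sq_eq_sq_iff_eq_or_eq_neg.1 hsq.1 with rfl | rfl <;>
        rcases sq_eq_sq_iff_eq_or_eq_neg.1 hsq.2 with rfl | rfl <;> simp
    · rintro (⟨rfl, rfl⟩ | ⟨rfl, rfl⟩ | ⟨rfl, rfl⟩ | ⟨rfl, rfl⟩) <;>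
        simpa [IsCoprime.neg_left_iff, IsCoprime.neg_right_iff] using ⟨h, hab⟩
  have ha' : a ≠ -a := by omega
  have hb' : b ≠ -b := by omega
  rw [hset, Set.ncard_coe_finset]
  simp [Finset.card_insert_of_notMem, ha', hb', hb'.symm]

theorem eq_one_of_mod_eight {p j a b : ℤ} (hj : j = 1 ∨ j = 4 ∨ j = 8) (hab : IsCoprime a b)
    (h : a ^ 2 + 216 * b ^ 2 = j * p) (hp : p % 8 = 1) : j = 1 := by
  have sq_mod : ∀ z : ℤ, z ^ 2 % 8 = 0 ∨ z ^ 2 % 8 = 1 ∨ z ^ 2 % 8 = 4 := by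
    intro z
    have h8 : z % 8 = 0 ∨ z % 8 = 1 ∨ z % 8 = 2 ∨ z % 8 = 3 ∨ z % 8 = 4 ∨ z % 8 = 5 ∨
      z % 8 = 6 ∨ z % 8 = 7 := by omega
    rcases h8 with h | h | h | h | h | h | h | h <;> simp [pow_two, Int.mul_emod, h]
  have odd_sq_mod : 2 ∣ a → b ^ 2 % 8 = 1 := by
    intro ha
    have hb : ¬ 2 ∣ b := fun hb => Int.prime_two.not_isUnit (hab.isUnit_of_dvd' ha hb)
    have h8 : b % 8 = 1 ∨ b % 8 = 3 ∨ b % 8 = 5 ∨ b % 8 = 7 := by omega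
    rcases h8 with h | h | h | h <;> simp [pow_two, Int.mul_emod, h]
  have ha := fun hd : (2 : ℤ) ∣ a ^ 2 => Int.prime_two.dvd_of_dvd_pow hd
  rcases hj with rfl | rfl | rfl
  · rfl
  · have h2 : (2 : ℤ) ∣ a := ha (by omega)
    have hb := odd_sq_mod h2
    obtain ⟨c, rfl⟩ := h2
    have hc := sq_mod c
    rw [mul_pow] at h
    omega
  · have h2 : (2 : ℤ) ∣ a := ha (by omega)
    have hb := odd_sq_mod h2
    obtain ⟨c, rfl⟩ := h2
    rw [mul_pow] at h
    obtain ⟨d, rfl⟩ : (2 : ℤ) ∣ c := Int.prime_two.dvd_of_dvd_pow (n := 2) (by omega)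
    have hd := sq_mod d
    rw [mul_pow] at h
    omega

theorem stmt9 (p : ℕ) (hp : p.Prime)
    (hP : ∃ j ∈ ({1, 4, 8} : Set ℤ), ∃ x y : ℤ,
      Int.gcd x y = 1 ∧ x ^ 2 + 216 * y ^ 2 = j * p)
    (m : ℕ) (hm : 0 < m) (hcop : Nat.Coprime p m) (hmod : (p * m) % 24 = 1) :
    (1 < m →
      Set.ncard {xy : ℤ × ℤ |
        xy.1 ^ 2 + 216 * xy.2 ^ 2 = (p : ℤ) * m ∧ Int.gcd xy.1 xy.2 = 1} % 8 = 0) ∧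
    (m = 1 →
      Set.ncard {xy : ℤ × ℤ |
        xy.1 ^ 2 + 216 * xy.2 ^ 2 = (p : ℤ) ∧ Int.gcd xy.1 xy.2 = 1} = 4) := by
  have hp' : Prime (p : ℤ) := Nat.prime_iff_prime_int.1 hp
  obtain ⟨j, hj, a, b, hg, h⟩ := hP
  rw [Set.mem_insert_iff, Set.mem_insert_iff, Set.mem_singleton_iff] at hj
  have hab := Int.isCoprime_iff_gcd_eq_one.2 hg
  constructor
  · intro hm1
    refine Nat.mod_eq_zero_of_dvd (eight_dvd_ncard (k := ((p * m / 24 : ℕ) : ℤ)) hp' ?_ hj hab h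
      ?_ ?_)
    · rw [Int.natCast_dvd_natCast]
      exact (Nat.Prime.coprime_iff_not_dvd hp).1 hcop
    · have h1 := Nat.div_add_mod (p * m) 24
      rw [hmod] at h1
      exact_mod_cast h1.symm
    · exact_mod_cast hm1.ne'
  · rintro rfl
    rw [mul_one] at hmod
    obtain rfl := eq_one_of_mod_eight hj hab h (by omega)
    rw [one_mul] at h
    have ha : a ≠ 0 := by
      rintro rfl
      omega
    have hb : b ≠ 0 := by
      rintro rfl
      exact hp'.irreducible.not_isSquare ⟨a, by linear_combination -h⟩
    exact ncard_primitive_prime hp' hab ha hb h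
end

section
/- Let p be a prime in 𝒫 and let m be a positive integer with p ∤ m and pm ≡ 1 (mod 24). Then M₁(pm) ≡ M₂(pm) (mod 8), where M₁(w) is the number of pairs (x,y) ∈ ℤ² with x² + 24y² = w and M₂(w) is the number of pairs (x,y) ∈ ℤ² with x² + 216y² = w. -/
/-- A finite set on which an involution exchanges a predicate with its negation has twice as many
elements as the part satisfying the predicate. -/
lemma ncard_eq_two_mul_of_involutive {α : Type*} {S : Set α} (hS : S.Finite) {f : α → α}
    (hf : Function.Involutive f) (P : α → Prop)
    (h : ∀ x ∈ S, f x ∈ S ∧ (P (f x) ↔ ¬ P x)) :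
    S.ncard = 2 * {x ∈ S | P x}.ncard := by
  have himage : S \ {x ∈ S | P x} = f '' {x ∈ S | P x} := by
    ext x
    simp only [Set.mem_sdiff, Set.mem_ofPred_eq, Set.mem_image]
    constructor
    · rintro ⟨hx, hPx⟩
      exact ⟨f x, ⟨(h x hx).1, (h x hx).2.2 fun hp => hPx ⟨hx, hp⟩⟩, hf x⟩
    · rintro ⟨y, ⟨hy, hPy⟩, rfl⟩
      exact ⟨(h y hy).1, fun hp => (h y hy).2.1 hp.2 hPy⟩
  have hsub : {x ∈ S | P x} ⊆ S := fun x hx => hx.1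
  have := Set.ncard_sdiff_add_ncard_of_subset hsub hS
  rw [himage, Set.ncard_image_of_injective _ hf.injective] at this
  omega

lemma finite_representations {A B : ℤ} (hA : 0 < A) (hB : 0 < B) (n : ℤ) :
    {xy : ℤ × ℤ | A * xy.1 ^ 2 + B * xy.2 ^ 2 = n}.Finite := by
  refine ((Set.finite_Icc (-n) n).prod (Set.finite_Icc (-n) n)).subset ?_
  rintro ⟨x, y⟩ h
  simp only [Set.mem_ofPred_eq] at h
  have hx : x ^ 2 ≤ n := by nlinarith [sq_nonneg x, sq_nonneg y]
  have hy : y ^ 2 ≤ n := by nlinarith [sq_nonneg x, sq_nonneg y]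
  have key : ∀ z : ℤ, z ^ 2 ≤ n → -n ≤ z ∧ z ≤ n := fun z hz =>
    ⟨by nlinarith [Int.le_self_sq (-z)], by nlinarith [Int.le_self_sq z]⟩
  exact ⟨key x hx, key y hy⟩

lemma involutive_neg_fst : Function.Involutive fun z : ℤ × ℤ => (-z.1, z.2) := fun z => by simp

lemma involutive_neg_snd : Function.Involutive fun z : ℤ × ℤ => (z.1, -z.2) := fun z => by simp

/-- Sign changes group the representations by `A * x ^ 2 + B * y ^ 2` with `3 ∤ y` into
quadruples, provided that `x` cannot vanish. -/
lemma four_dvd_ncard_representations {A B n : ℤ} (hA : 0 < A) (hB : 0 < B)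
    (hn : ∀ y : ℤ, B * y ^ 2 ≠ n) :
    4 ∣ {xy : ℤ × ℤ | A * xy.1 ^ 2 + B * xy.2 ^ 2 = n ∧ ¬ 3 ∣ xy.2}.ncard := by
  have hfin : {xy : ℤ × ℤ | A * xy.1 ^ 2 + B * xy.2 ^ 2 = n ∧ ¬ 3 ∣ xy.2}.Finite :=
    (finite_representations hA hB n).subset fun x hx => hx.1
  rw [ncard_eq_two_mul_of_involutive hfin involutive_neg_fst (fun z => 0 < z.1),
    ncard_eq_two_mul_of_involutive (hfin.subset fun x hx => hx.1) involutive_neg_snd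
      (fun z => 0 < z.2)]
  · omega
  · rintro ⟨x, y⟩ ⟨⟨h, h3⟩, hx⟩
    simp only [Set.mem_ofPred_eq] at *
    refine ⟨⟨⟨by rw [← h]; ring, by omega⟩, hx⟩, by omega⟩
  · rintro ⟨x, y⟩ ⟨h, h3⟩
    simp only [Set.mem_ofPred_eq] at *
    have hx : x ≠ 0 := by
      rintro rfl
      exact hn y (by linarith)
    refine ⟨⟨by rw [← h]; ring, h3⟩, by omega⟩

lemma even_of_sq_add_six_mul_sq {X Y n : ℤ} (hn : n % 24 = 1) (h : X ^ 2 + 6 * Y ^ 2 = n) :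
    2 ∣ Y := by
  by_contra hY
  obtain ⟨k, rfl⟩ : ∃ k, Y = 2 * k + 1 := ⟨Y / 2, by omega⟩
  rcases Int.even_or_odd' X with ⟨c, rfl | rfl⟩
  · have : (2 * c) ^ 2 + 6 * (2 * k + 1) ^ 2 = 2 * (2 * c ^ 2 + 3 * (2 * k + 1) ^ 2) := by ring
    omega
  · have : (2 * c + 1) ^ 2 + 6 * (2 * k + 1) ^ 2 =
        4 * (c ^ 2 + c + 6 * k ^ 2 + 6 * k + 1) + 3 := by ring
    omega

/-- Composition with a fixed representation of the prime `p` by `A * u ^ 2 + 9 * B * v ^ 2` is a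
bijection from the representations of `m` onto half of those of `p * m`. -/
lemma eight_dvd_ncard_representations {A B p m u v : ℤ} (hA : 0 < A) (hB : 0 < B)
    (hAB : A * B = 6) (hp : Prime p) (hrep : p = A * u ^ 2 + 9 * B * v ^ 2)
    (hpm : ¬ p ∣ m) (hmod : (p * m) % 24 = 1) (h2 : ¬ p ∣ 2) (h3 : ¬ p ∣ 3) :
    8 ∣ {xy : ℤ × ℤ | xy.1 ^ 2 + 24 * xy.2 ^ 2 = p * m ∧ ¬ 3 ∣ xy.2}.ncard := by
  have h6 : ¬ p ∣ 6 := fun h => by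
    rcases hp.dvd_or_dvd (show p ∣ 2 * 3 from h) with h | h
    exacts [h2 h, h3 h]
  have hpA : ¬ p ∣ A := fun h => h6 (hAB ▸ h.mul_right B)
  have hpB : ¬ p ∣ B := fun h => h6 (hAB ▸ h.mul_left A)
  have hnsq : ∀ c : ℤ, ¬ p = p ^ 2 * c := fun c hc => hp.not_isUnit
    (IsUnit.of_mul_eq_one c (mul_left_cancel₀ hp.ne_zero (by linear_combination -hc)))
  have hpu : ¬ p ∣ u := by
    rintro ⟨c, hc⟩
    have hd : p ∣ 3 * (3 * (B * v ^ 2)) := ⟨1 - A * p * c ^ 2, by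
      rw [hc] at hrep; linear_combination -hrep⟩
    simp only [hp.dvd_mul, h3, hpB, false_or] at hd
    obtain ⟨d, hd⟩ := hp.dvd_of_dvd_pow hd
    exact hnsq (A * c ^ 2 + 9 * B * d ^ 2) (by rw [hc, hd] at hrep; linear_combination hrep)
  have hpv : ¬ p ∣ v := by
    rintro ⟨c, hc⟩
    have hd : p ∣ A * u ^ 2 := ⟨1 - 9 * B * p * c ^ 2, by
      rw [hc] at hrep; linear_combination -hrep⟩
    rcases hp.dvd_or_dvd hd with h | h
    · exact hpA h
    · exact hpu (hp.dvd_of_dvd_pow h)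
  have h3p : ¬ 3 ∣ p := fun h => by
    obtain ⟨c, hc⟩ := h
    rw [hc, mul_assoc] at hmod
    omega
  have h3u : ¬ 3 ∣ u := by
    rintro ⟨c, rfl⟩
    exact h3p ⟨3 * A * c ^ 2 + 3 * B * v ^ 2, by linear_combination hrep⟩
  have h3B : ∀ y : ℤ, B * y ^ 2 ≠ m := by
    rintro y rfl
    have h3B : 3 ∣ B := by
      by_contra hB3
      have h3A : 3 ∣ A :=
        (Int.prime_three.dvd_or_dvd (show (3 : ℤ) ∣ A * B by rw [hAB]; norm_num)).resolve_right hB3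
      exact h3p (hrep ▸ dvd_add (h3A.mul_right _) ⟨3 * B * v ^ 2, by ring⟩)
    obtain ⟨c, hc⟩ : (3 : ℤ) ∣ p * (B * y ^ 2) := (h3B.mul_right _).mul_left _
    omega
  have hfin : {xy : ℤ × ℤ | xy.1 ^ 2 + 24 * xy.2 ^ 2 = p * m ∧ ¬ 3 ∣ xy.2}.Finite :=
    (finite_representations one_pos (show (0 : ℤ) < 24 by norm_num) (p * m)).subset
      fun x hx => by simpa using hx.1
  rw [ncard_eq_two_mul_of_involutive hfin involutive_neg_snd
    (fun z => p ∣ A * u * (2 * z.2) - 3 * v * z.1)]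
  · obtain ⟨k, hk⟩ := four_dvd_ncard_representations hA hB h3B
    suffices h : {xy : ℤ × ℤ | A * xy.1 ^ 2 + B * xy.2 ^ 2 = m ∧ ¬ 3 ∣ xy.2}.ncard =
        {z ∈ {xy : ℤ × ℤ | xy.1 ^ 2 + 24 * xy.2 ^ 2 = p * m ∧ ¬ 3 ∣ xy.2} |
          p ∣ A * u * (2 * z.2) - 3 * v * z.1}.ncard by omega
    have hY : ∀ a b : ℤ, A * a ^ 2 + B * b ^ 2 = m → 2 ∣ u * b + 3 * v * a := fun a b h =>
      even_of_sq_add_six_mul_sq (X := A * u * a - 3 * B * v * b) hmod (by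
        rw [← h, ← hAB]
        linear_combination -(A * a ^ 2 + B * b ^ 2) * hrep)
    refine Set.ncard_congr
      (fun z _ => (A * u * z.1 - 3 * B * v * z.2, (u * z.2 + 3 * v * z.1) / 2)) ?_ ?_ ?_
    · rintro ⟨a, b⟩ ⟨h, hb⟩
      simp only [Set.mem_ofPred_eq] at *
      obtain ⟨y, hy⟩ := hY a b h
      rw [hy, Int.mul_ediv_cancel_left _ two_ne_zero]
      refine ⟨⟨?_, fun h3y => ?_⟩, b, ?_⟩
      · rw [← h, hrep]
        linear_combination (-6 * (u * b + 3 * v * a + 2 * y)) * hy -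
          (u * b + 3 * v * a) ^ 2 * hAB
      · have : (3 : ℤ) ∣ u * b := by
          obtain ⟨c, rfl⟩ := h3y
          exact ⟨2 * c - v * a, by linear_combination hy⟩
        rcases Int.prime_three.dvd_or_dvd this with h | h
        exacts [h3u h, hb h]
      · linear_combination -A * u * hy - b * hrep
    · rintro ⟨a, b⟩ ⟨a', b'⟩ ⟨h, -⟩ ⟨h', -⟩ heq
      simp only [Prod.mk.injEq] at *
      obtain ⟨hX, hY'⟩ := heq
      have hYY : u * b + 3 * v * a = u * b' + 3 * v * a' := by
        have := hY a b h
        have := hY a' b' h'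
        omega
      constructor
      · refine mul_left_cancel₀ hp.ne_zero ?_
        linear_combination u * hX + 3 * B * v * hYY + (a - a') * hrep
      · refine mul_left_cancel₀ hp.ne_zero ?_
        linear_combination -3 * v * hX + A * u * hYY + (b - b') * hrep
    · rintro ⟨X, Y⟩ ⟨⟨h, h3Y⟩, b, hb⟩
      simp only at h h3Y hb
      obtain ⟨a, ha⟩ : p ∣ u * X + 3 * B * v * (2 * Y) := by
        have hd : p ∣ A * (u * (u * X + 3 * B * v * (2 * Y))) :=
          ⟨X + 3 * B * v * b, by linear_combination 3 * B * v * hb - X * hrep⟩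
        simpa only [hp.dvd_mul, hpA, hpu, false_or] using hd
      have hX : A * u * a - 3 * B * v * b = X := by
        refine mul_left_cancel₀ hp.ne_zero ?_
        linear_combination -A * u * ha + 3 * B * v * hb - X * hrep
      have hY' : u * b + 3 * v * a = 2 * Y := by
        refine mul_left_cancel₀ hp.ne_zero ?_
        linear_combination -u * hb - 3 * v * ha - 2 * Y * hrep
      refine ⟨(a, b), ⟨?_, ?_⟩, ?_⟩
      · refine mul_left_cancel₀ hp.ne_zero ?_
        simp only
        rw [← h, ← hX]
        linear_combination (A * a ^ 2 + B * b ^ 2) * hrep +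
          6 * (u * b + 3 * v * a + 2 * Y) * hY' + (u * b + 3 * v * a) ^ 2 * hAB
      · rintro ⟨c, hc⟩
        simp only at hc
        have : (3 : ℤ) ∣ 2 * Y := ⟨u * c + v * a, by rw [← hY', hc]; ring⟩
        omega
      · simp only [Prod.mk.injEq]
        exact ⟨hX, by omega⟩
  · rintro ⟨X, Y⟩ ⟨h, h3Y⟩
    simp only [Set.mem_ofPred_eq] at *
    refine ⟨⟨by rw [← h]; ring, by omega⟩, ?_⟩
    have hprod : p ∣ (A * u * (2 * -Y) - 3 * v * X) * (A * u * (2 * Y) - 3 * v * X) :=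
      ⟨9 * v ^ 2 * m - 4 * A * Y ^ 2, by
        linear_combination 9 * v ^ 2 * h + 4 * A * Y ^ 2 * hrep + 36 * v ^ 2 * Y ^ 2 * hAB⟩
    constructor
    · rintro ⟨c, hc⟩ ⟨d, hd⟩
      have hY : p ∣ Y := by
        have : p ∣ 2 * (2 * (A * (u * Y))) := ⟨d - c, by linear_combination hd - hc⟩
        simpa only [hp.dvd_mul, h2, hpA, hpu, false_or] using this
      have hX : p ∣ X := by
        have : p ∣ 2 * (3 * (v * X)) := ⟨-c - d, by linear_combination -hd - hc⟩
        simpa only [hp.dvd_mul, h2, h3, hpv, false_or] using this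
      obtain ⟨x, rfl⟩ := hX
      obtain ⟨y, rfl⟩ := hY
      exact hpm ⟨x ^ 2 + 24 * y ^ 2, mul_left_cancel₀ hp.ne_zero (by linear_combination -h)⟩
    · exact (hp.dvd_or_dvd hprod).resolve_right

lemma exists_eq_of_sq_add_216_mul_sq {j p : ℤ} (hj : j ∈ ({1, 4, 8} : Set ℤ))
    (h : ∃ x y : ℤ, x ^ 2 + 216 * y ^ 2 = j * p) :
    ∃ A B u v : ℤ, 0 < A ∧ 0 < B ∧ A * B = 6 ∧ p = A * u ^ 2 + 9 * B * v ^ 2 := by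
  obtain ⟨x, y, h⟩ := h
  have even_of_sq : ∀ z w : ℤ, z ^ 2 = 2 * w → ∃ c, z = 2 * c := fun z w hz =>
    Int.prime_two.dvd_of_dvd_pow ⟨w, hz⟩
  rcases hj with rfl | rfl | rfl
  · exact ⟨1, 6, x, 2 * y, by norm_num, by norm_num, by norm_num, by linarith⟩
  · obtain ⟨c, rfl⟩ := even_of_sq x (2 * p - 108 * y ^ 2) (by linarith)
    exact ⟨1, 6, c, y, by norm_num, by norm_num, by norm_num, by linarith⟩
  · obtain ⟨c, rfl⟩ := even_of_sq x (4 * p - 108 * y ^ 2) (by linarith)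
    obtain ⟨d, rfl⟩ := even_of_sq c (p - 27 * y ^ 2) (by linarith)
    exact ⟨2, 3, d, y, by norm_num, by norm_num, by norm_num, by linarith⟩

lemma ncard_sq_add_24_mul_sq (n : ℤ) :
    {xy : ℤ × ℤ | xy.1 ^ 2 + 24 * xy.2 ^ 2 = n}.ncard =
      {xy : ℤ × ℤ | xy.1 ^ 2 + 24 * xy.2 ^ 2 = n ∧ ¬ 3 ∣ xy.2}.ncard +
      {xy : ℤ × ℤ | xy.1 ^ 2 + 216 * xy.2 ^ 2 = n}.ncard := by
  have hfin : {xy : ℤ × ℤ | xy.1 ^ 2 + 24 * xy.2 ^ 2 = n}.Finite := by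
    simpa using finite_representations one_pos (show (0 : ℤ) < 24 by norm_num) n
  have hinj : Function.Injective fun z : ℤ × ℤ => (z.1, 3 * z.2) := by
    rintro ⟨x, y⟩ ⟨x', y'⟩ h
    simp only [Prod.mk.injEq] at *
    omega
  have hsub : {xy : ℤ × ℤ | xy.1 ^ 2 + 24 * xy.2 ^ 2 = n ∧ ¬ 3 ∣ xy.2} ⊆
      {xy : ℤ × ℤ | xy.1 ^ 2 + 24 * xy.2 ^ 2 = n} := fun x hx => hx.1
  rw [← Set.ncard_sdiff_add_ncard_of_subset hsub hfin, add_comm,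
    ← Set.ncard_image_of_injective {xy : ℤ × ℤ | xy.1 ^ 2 + 216 * xy.2 ^ 2 = n} hinj]
  congr 2
  ext ⟨x, y⟩
  simp only [Set.mem_sdiff, Set.mem_ofPred_eq, Set.mem_image, Prod.exists, Prod.mk.injEq]
  constructor
  · rintro ⟨h, hy⟩
    obtain ⟨c, rfl⟩ : 3 ∣ y := by
      by_contra h3
      exact hy ⟨h, h3⟩
    exact ⟨x, c, by linarith, rfl, rfl⟩
  · rintro ⟨x, c, h, rfl, rfl⟩
    exact ⟨by linarith, fun h' => h'.2 (dvd_mul_right 3 c)⟩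

theorem stmt10 (p : ℕ) (hp : p.Prime)
    (hP : ∃ j ∈ ({1, 4, 8} : Set ℤ), ∃ x y : ℤ,
      Int.gcd x y = 1 ∧ x ^ 2 + 216 * y ^ 2 = j * p)
    (m : ℕ) (hm : 0 < m) (hpm : ¬ (p ∣ m)) (hmod : (p * m) % 24 = 1) :
    Set.ncard {xy : ℤ × ℤ | xy.1 ^ 2 + 24 * xy.2 ^ 2 = (p : ℤ) * m} ≡
    Set.ncard {xy : ℤ × ℤ | xy.1 ^ 2 + 216 * xy.2 ^ 2 = (p : ℤ) * m} [MOD 8] := by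
  obtain ⟨j, hj, x, y, -, hxy⟩ := hP
  obtain ⟨A, B, u, v, hA, hB, hAB, hrep⟩ := exists_eq_of_sq_add_216_mul_sq hj ⟨x, y, hxy⟩
  have hndvd : ∀ q : ℕ, q.Prime → q ∣ 24 → ¬ (p : ℤ) ∣ q := by
    intro q hq hq24 h
    obtain rfl := (Nat.prime_dvd_prime_iff_eq hp hq).1 (Int.natCast_dvd_natCast.1 h)
    have h1 : p ∣ (p * m) % 24 := (Nat.dvd_mod_iff hq24).2 (dvd_mul_right p m)
    rw [hmod] at h1
    exact hp.one_lt.ne' (Nat.dvd_one.1 h1)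
  have h8 := eight_dvd_ncard_representations (m := m) hA hB hAB (Nat.prime_iff_prime_int.1 hp)
    hrep (by exact_mod_cast hpm) (by exact_mod_cast hmod)
    (hndvd 2 Nat.prime_two (by norm_num)) (hndvd 3 Nat.prime_three (by norm_num))
  rw [ncard_sq_add_24_mul_sq]
  simpa using (Nat.modEq_zero_iff_dvd.2 h8).add_right
    {xy : ℤ × ℤ | xy.1 ^ 2 + 216 * xy.2 ^ 2 = (p : ℤ) * m}.ncard
end
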